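/- Let $n\ge 1$ and $0\le\alpha<n$. For measurable $p:\mathbb{R}^n\to(0,\infty)$ and measurable $g:\mathbb{R}^n\to[0,\infty]$ put $$\|g\|_{p(\cdot)}=\inf\Big\{\lambda>0:\int_{\mathbb{R}^n}\big(g(x)/\lambda\big)^{p(x)}\,dx\le 1\Big\}$$ (with $\inf\emptyset=\infty$), and put $p_-=\inf_{\mathbb{R}^n} p$, $p_+=\sup_{\mathbb{R}^n} p$. For locally integrable $f$ let $$M_\alpha f(x)=\sup_{Q\ni x}|Q|^{\frac{\alpha}{n}-1}\int_Q|f(y)|\,dy,$$ where the supremum is taken over all cubes $Q\subset\mathbb{R}^n$ (with sides parallel to the axes) containing $x$; for $\alpha=0$ this is the Hardy–Littlewood maximal operator. Let $p:\mathbb{R}^n\to(1,\infty)$ satisfy the local log-Hölder condition (there is $c>0$ with $|p(x)-p(y)|\le \frac{c}{-\log|x-y|}$ whenever $|x-y|<\frac12$) and the log-Hölder condition at infinity (there are $C_\infty>0$ and $p_\infty\in\mathbb{R}$ with $|p(x)-p_\infty|\le\frac{C_\infty}{\log(e+|x|)}$ for all $x\in\mathbb{R}^n$), and suppose that $1<p_-\le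 p_+<\frac{n}{\alpha}$ (meaning $p_+<\infty$ when $\alpha=0$). Define $q:\mathbb{R}^n\to(1,\infty)$ by $\frac{1}{q(x)}=\frac{1}{p(x)}-\frac{\alpha}{n}$. Then for every $\theta\in(1,\infty)$ there is a constant $C>0$ such that $$\Big\|\Big(\sum_{j=1}^\infty (M_\alpha f_j)^\theta\Big)^{1/\theta}\Big\|_{q(\cdot)}\le C\,\Big\|\Big(\sum_{j=1}^\infty |f_j|^\theta\Big)^{1/\theta}\Big\|_{p(\cdot)}$$ for all sequences $\{f_j\}_{j=1}^\infty$ of bounded measurable functions on $\mathbb{R}^n$ with compact support, where the sums take values in $[0,\infty]$. -/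

import Mathlib

open MeasureTheory
open scoped ENNReal

noncomputable section

/-- `ℝⁿ` with the Euclidean norm and Lebesgue measure. -/
abbrev Rn (n : ℕ) := EuclideanSpace ℝ (Fin n)

/-- The variable Lebesgue quasinorm
`‖g‖_{p(·)} = inf {lam > 0 : ∫ (g(x) / lam) ^ p(x) dx ≤ 1}` of a function `g : ℝⁿ → [0, ∞]`;
it is `∞` if there is no such `lam`. -/
def varLpNorm {n : ℕ} (p : Rn n → ℝ) (g : Rn n → ℝ≥0∞) : ℝ≥0∞ :=
  sInf (ENNReal.ofReal ''
    {lam : ℝ | 0 < lam ∧ (∫⁻ x, (g x / ENNReal.ofReal lam) ^ (p x)) ≤ 1})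

/-- The local log-Hölder condition. (For `x = y` both sides are `0`.) -/
def LogHolderLocal {n : ℕ} (p : Rn n → ℝ) : Prop :=
  ∃ c : ℝ, 0 < c ∧ ∀ x y : Rn n, ‖x - y‖ < 1 / 2 → |p x - p y| ≤ c / (-Real.log ‖x - y‖)

/-- The log-Hölder condition at infinity. -/
def LogHolderInfty {n : ℕ} (p : Rn n → ℝ) : Prop :=
  ∃ C : ℝ, 0 < C ∧ ∃ pinf : ℝ, ∀ x : Rn n,
    |p x - pinf| ≤ C / Real.log (Real.exp 1 + ‖x‖)

/-- The (closed) cube `Q(z, r)` with center `z`, side length `r` and sides parallel to the axes. -/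
def cube {n : ℕ} (z : Rn n) (r : ℝ) : Set (Rn n) := {x | ∀ i, |x i - z i| ≤ r / 2}

/-- The fractional maximal operator
`M_α f(x) = sup_{Q ∋ x} |Q| ^ (α / n - 1) * ∫_Q |f(y)| dy`, with values in `[0, ∞]`. -/
def fracMax {n : ℕ} {𝕜 : Type*} [RCLike 𝕜] (α : ℝ) (f : Rn n → 𝕜) (x : Rn n) : ℝ≥0∞ :=
  ⨆ (z : Rn n) (r : ℝ) (_ : 0 < r) (_ : x ∈ cube z r),
    volume (cube z r) ^ (α / (n : ℝ) - 1) * ∫⁻ y in cube z r, ‖f y‖ₑ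

end

open MeasureTheory
open scoped ENNReal

noncomputable section

/-! ### Auxiliary facts on `[0, ∞]`-valued functions -/

theorem lintegral_Ioi_ite_rpow (a : ℝ≥0∞) {r : ℝ} (hr : 0 < r) :
    ∫⁻ t in Set.Ioi (0 : ℝ), (if ENNReal.ofReal t < a then ENNReal.ofReal (t ^ (r - 1)) else 0)
      = a ^ r / ENNReal.ofReal r := by
  have hr0 : ENNReal.ofReal r ≠ 0 := by simpa using hr
  have key : ∀ b : ℝ, 0 ≤ b → ∫⁻ t in Set.Ioi (0 : ℝ),
      (if ENNReal.ofReal t < ENNReal.ofReal b then ENNReal.ofReal (t ^ (r - 1)) else 0)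
      = ENNReal.ofReal b ^ r / ENNReal.ofReal r := by
    intro b hb
    have h := lintegral_rpow_eq_lintegral_meas_lt_mul (Measure.dirac ()) (f := fun _ => b)
      (Filter.Eventually.of_forall fun _ => hb) aemeasurable_const hr
    rw [lintegral_dirac, ← ENNReal.ofReal_rpow_of_nonneg hb hr.le] at h
    rw [h, mul_comm, ENNReal.mul_div_cancel_right hr0 ENNReal.ofReal_ne_top]
    refine setLIntegral_congr_fun measurableSet_Ioi fun t ht => ?_
    have ht' : (0 : ℝ) < t := ht
    by_cases htb : t < b
    · simp [htb, ENNReal.ofReal_lt_ofReal_iff (ht'.trans htb)]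
    · have : ¬ ENNReal.ofReal t < ENNReal.ofReal b :=
        not_lt.2 (ENNReal.ofReal_le_ofReal (not_lt.1 htb))
      simp [htb, this]
  by_cases ha : a = ⊤
  · subst ha
    rw [ENNReal.top_rpow_of_pos hr, ENNReal.top_div_of_ne_top ENNReal.ofReal_ne_top]
    have hle : ∀ N : ℕ, (N : ℝ≥0∞) ^ r / ENNReal.ofReal r ≤ ∫⁻ t in Set.Ioi (0 : ℝ),
        (if ENNReal.ofReal t < ⊤ then ENNReal.ofReal (t ^ (r - 1)) else 0) := by
      intro N
      have := key N (Nat.cast_nonneg N)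
      rw [ENNReal.ofReal_natCast] at this
      rw [← this]
      refine lintegral_mono fun t => ?_
      split_ifs <;> simp_all
    by_contra hne
    set I := ∫⁻ t in Set.Ioi (0 : ℝ),
        (if ENNReal.ofReal t < ⊤ then ENNReal.ofReal (t ^ (r - 1)) else 0)
    have hJ : (I * ENNReal.ofReal r) ^ (1 / r) ≠ ⊤ :=
      ENNReal.rpow_ne_top_of_nonneg (by positivity) (ENNReal.mul_ne_top hne ENNReal.ofReal_ne_top)
    obtain ⟨N, hN⟩ := ENNReal.exists_nat_gt hJ
    have h1 : (N : ℝ≥0∞) ^ r ≤ I * ENNReal.ofReal r :=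
      (ENNReal.div_le_iff hr0 ENNReal.ofReal_ne_top).1 (hle N)
    have h2 := ENNReal.rpow_le_rpow h1 (one_div_nonneg.2 hr.le)
    rw [← ENNReal.rpow_mul, mul_one_div_cancel hr.ne', ENNReal.rpow_one] at h2
    exact absurd hN (not_lt.2 h2)
  · have := key a.toReal ENNReal.toReal_nonneg
    rwa [ENNReal.ofReal_toReal ha] at this

/-- A strong type inequality from a truncated weak type inequality. -/
theorem lintegral_rpow_le_of_weak {X : Type*} [MeasurableSpace X] {μ : Measure X} [SFinite μ]
    {F G : X → ℝ≥0∞} (hF : Measurable F) (hG : Measurable G) {s : ℝ} (hs : 1 < s)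
    (h : ∀ t : ℝ, 0 < t → ENNReal.ofReal t * μ {x | ENNReal.ofReal t < F x} ≤
      2 * ∫⁻ x in {x | ENNReal.ofReal t < 2 * G x}, G x ∂μ) :
    ∫⁻ x, F x ^ s ∂μ ≤ ENNReal.ofReal (2 ^ s * s / (s - 1)) * ∫⁻ x, G x ^ s ∂μ := by
  have hs0 : 0 < s := by linarith
  have hs1 : 0 < s - 1 := by linarith
  have hsr : ENNReal.ofReal s ≠ 0 := by simpa using hs0
  have hsr1 : ENNReal.ofReal (s - 1) ≠ 0 := by simpa using hs
  have swap : ∀ (H : X → ℝ≥0∞) (W : X → ℝ≥0∞) (r : ℝ), Measurable H → Measurable W → 0 < r →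
      ∫⁻ x, W x * (H x ^ r / ENNReal.ofReal r) ∂μ = ∫⁻ t in Set.Ioi (0 : ℝ),
        ENNReal.ofReal (t ^ (r - 1)) * ∫⁻ x in {x | ENNReal.ofReal t < H x}, W x ∂μ := by
    intro H W r hH hW hr
    have hms : MeasurableSet {z : X × ℝ | ENNReal.ofReal z.2 < H z.1} :=
      measurableSet_lt (by fun_prop) (by fun_prop)
    calc ∫⁻ x, W x * (H x ^ r / ENNReal.ofReal r) ∂μ
        = ∫⁻ x, (∫⁻ t in Set.Ioi (0 : ℝ), W x *
            (if ENNReal.ofReal t < H x then ENNReal.ofReal (t ^ (r - 1)) else 0)) ∂μ := by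
          refine lintegral_congr fun x => ?_
          rw [lintegral_const_mul, lintegral_Ioi_ite_rpow _ hr]
          refine Measurable.ite (measurableSet_lt (by fun_prop) measurable_const) ?_ measurable_const
          fun_prop
      _ = ∫⁻ t in Set.Ioi (0 : ℝ), ∫⁻ x, W x *
            (if ENNReal.ofReal t < H x then ENNReal.ofReal (t ^ (r - 1)) else 0) ∂μ := by
          refine lintegral_lintegral_swap (Measurable.aemeasurable ?_)
          refine Measurable.mul (by fun_prop) (Measurable.ite hms (by fun_prop) measurable_const)
      _ = _ := by
          refine lintegral_congr fun t => ?_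
          have hmt : MeasurableSet {x | ENNReal.ofReal t < H x} :=
            measurableSet_lt measurable_const hH
          rw [← lintegral_const_mul _ hW, ← lintegral_indicator hmt]
          refine lintegral_congr fun x => ?_
          by_cases hx : ENNReal.ofReal t < H x
          · simp [Set.indicator, hx, mul_comm]
          · simp [Set.indicator, hx]
  have h1 : ∫⁻ x, F x ^ s ∂μ = ENNReal.ofReal s * ∫⁻ x, 1 * (F x ^ s / ENNReal.ofReal s) ∂μ := by
    rw [← lintegral_const_mul _ (by fun_prop)]
    refine lintegral_congr fun x => ?_
    rw [one_mul, ENNReal.mul_div_cancel hsr ENNReal.ofReal_ne_top]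
  rw [h1, swap F (fun _ => 1) s hF measurable_const hs0]
  have h2 : ∫⁻ t in Set.Ioi (0 : ℝ), ENNReal.ofReal (t ^ (s - 1)) *
      ∫⁻ x in {x | ENNReal.ofReal t < F x}, 1 ∂μ ≤
      ∫⁻ t in Set.Ioi (0 : ℝ), 2 * (ENNReal.ofReal (t ^ (s - 1 - 1)) *
        ∫⁻ x in {x | ENNReal.ofReal t < 2 * G x}, G x ∂μ) := by
    refine setLIntegral_mono_ae' measurableSet_Ioi (Filter.Eventually.of_forall fun t ht => ?_)
    have ht' : (0 : ℝ) < t := ht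
    have e : t ^ (s - 1) = t ^ (s - 1 - 1) * t := by
      rw [Real.rpow_sub_one ht'.ne' (s - 1)]; field_simp
    rw [e, ENNReal.ofReal_mul (by positivity), setLIntegral_one, mul_assoc, mul_left_comm 2]
    exact mul_le_mul' le_rfl (h t ht')
  refine (mul_le_mul_right h2 _).trans ?_
  have hmeas : Measurable fun t : ℝ => ∫⁻ x in {x | ENNReal.ofReal t < 2 * G x}, G x ∂μ := by
    have : (fun t : ℝ => ∫⁻ x in {x | ENNReal.ofReal t < 2 * G x}, G x ∂μ) = fun t : ℝ =>
        ∫⁻ x, (if ENNReal.ofReal t < 2 * G x then G x else 0) ∂μ := by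
      funext t
      rw [← lintegral_indicator (measurableSet_lt measurable_const (by fun_prop))]
      refine lintegral_congr fun x => ?_
      by_cases hx : ENNReal.ofReal t < 2 * G x <;> simp [Set.indicator, hx]
    rw [this]
    refine Measurable.lintegral_prod_right'
      (f := fun z : ℝ × X => if ENNReal.ofReal z.1 < 2 * G z.2 then G z.2 else 0) ?_
    exact Measurable.ite (measurableSet_lt (by fun_prop) (by fun_prop)) (by fun_prop)
      measurable_const
  rw [lintegral_const_mul _ (by fun_prop), ← swap (fun x => 2 * G x) G (s - 1) (by fun_prop) hG hs1]
  have h3 : ∀ x, G x * ((2 * G x) ^ (s - 1) / ENNReal.ofReal (s - 1)) =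
      (2 ^ (s - 1) / ENNReal.ofReal (s - 1)) * G x ^ s := by
    intro x
    have : G x ^ s = G x * G x ^ (s - 1) := by
      conv_rhs => rw [← ENNReal.rpow_one (G x), ← ENNReal.rpow_mul, one_mul,
        ← ENNReal.rpow_add_of_nonneg _ _ zero_le_one hs1.le]
      congr 1; ring
    rw [this, ENNReal.mul_rpow_of_nonneg _ _ hs1.le, div_eq_mul_inv, div_eq_mul_inv]
    ring
  simp_rw [h3]
  rw [lintegral_const_mul _ (by fun_prop), ← mul_assoc, ← mul_assoc]
  gcongr
  have e2 : (2 : ℝ≥0∞) ^ (s - 1) = ENNReal.ofReal (2 ^ (s - 1)) := by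
    rw [← ENNReal.ofReal_rpow_of_pos two_pos]; simp
  have e3 : (2 : ℝ≥0∞) = ENNReal.ofReal 2 := by simp
  rw [e2, ← ENNReal.ofReal_div_of_pos hs1, e3, ← ENNReal.ofReal_mul hs0.le,
    ← ENNReal.ofReal_mul (by positivity)]
  refine ENNReal.ofReal_le_ofReal (le_of_eq ?_)
  rw [Real.rpow_sub_one two_ne_zero]
  field_simp

/-- The `ℓ^θ` norm of a sequence in `[0, ∞]`. -/
def seqNorm (θ : ℝ) (a : ℕ → ℝ≥0∞) : ℝ≥0∞ := (∑' j, a j ^ θ) ^ (1 / θ)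

theorem seqNorm_rpow {θ : ℝ} (hθ : 0 < θ) (a : ℕ → ℝ≥0∞) : seqNorm θ a ^ θ = ∑' j, a j ^ θ := by
  rw [seqNorm, ← ENNReal.rpow_mul, one_div_mul_cancel hθ.ne', ENNReal.rpow_one]

theorem seqNorm_mono {θ : ℝ} (hθ : 0 < θ) {a b : ℕ → ℝ≥0∞} (h : ∀ j, a j ≤ b j) :
    seqNorm θ a ≤ seqNorm θ b := by
  unfold seqNorm
  gcongr
  · exact h _

theorem le_seqNorm {θ : ℝ} (hθ : 0 < θ) (a : ℕ → ℝ≥0∞) (j : ℕ) : a j ≤ seqNorm θ a := by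
  have h := ENNReal.rpow_le_rpow (ENNReal.le_tsum (f := fun j => a j ^ θ) j)
    (one_div_nonneg.2 hθ.le)
  simpa only [seqNorm, ← ENNReal.rpow_mul, mul_one_div_cancel hθ.ne', ENNReal.rpow_one] using h

theorem seqNorm_const_mul {θ : ℝ} (hθ : 0 < θ) (c : ℝ≥0∞) (a : ℕ → ℝ≥0∞) :
    seqNorm θ (fun j => c * a j) = c * seqNorm θ a := by
  simp only [seqNorm, ENNReal.mul_rpow_of_nonneg _ _ hθ.le, ENNReal.tsum_mul_left]
  rw [ENNReal.mul_rpow_of_nonneg _ _ (one_div_nonneg.2 hθ.le), ← ENNReal.rpow_mul,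
    mul_one_div_cancel hθ.ne', ENNReal.rpow_one]

theorem seqNorm_add_le {θ : ℝ} (hθ : 1 ≤ θ) (a b : ℕ → ℝ≥0∞) :
    seqNorm θ (fun j => a j + b j) ≤ seqNorm θ a + seqNorm θ b := by
  have := ENNReal.lintegral_Lp_add_le (μ := (Measure.count : Measure ℕ)) (f := a) (g := b)
    (Measurable.of_discrete.aemeasurable) (Measurable.of_discrete.aemeasurable) hθ
  simpa only [seqNorm, lintegral_count, Pi.add_apply] using this

theorem measurable_seqNorm {X : Type*} [MeasurableSpace X] (θ : ℝ) {f : ℕ → X → ℝ≥0∞}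
    (hf : ∀ j, Measurable (f j)) : Measurable fun x => seqNorm θ fun j => f j x := by
  unfold seqNorm
  exact (Measurable.tsum fun j => (hf j).pow_const θ).pow_const _

/-- Minkowski's integral inequality for `ℓ^θ`. -/
theorem seqNorm_lintegral_le {X : Type*} [MeasurableSpace X] {μ : Measure X} {θ : ℝ} (hθ : 1 < θ)
    {f : ℕ → X → ℝ≥0∞} (hf : ∀ j, Measurable (f j)) :
    seqNorm θ (fun j => ∫⁻ x, f j x ∂μ) ≤ ∫⁻ x, seqNorm θ (fun j => f j x) ∂μ := by
  have hθ0 : 0 < θ := by linarith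
  set I := ∫⁻ x, seqNorm θ (fun j => f j x) ∂μ with hI
  by_cases hItop : I = ⊤
  · rw [hItop]; exact le_top
  have hfin : ∀ j, ∫⁻ x, f j x ∂μ ≠ ⊤ := fun j =>
    ne_top_of_le_ne_top hItop (lintegral_mono fun x => le_seqNorm hθ0 (fun j => f j x) j)
  have hpq := Real.HolderConjugate.conjExponent hθ
  set θ' := θ.conjExponent
  have hstep : ∀ N : ℕ, (∑ j ∈ Finset.range N, (∫⁻ x, f j x ∂μ) ^ θ) ^ (1 / θ) ≤ I := by
    intro N
    set S := ∑ j ∈ Finset.range N, (∫⁻ x, f j x ∂μ) ^ θ with hS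
    have hStop : S ≠ ⊤ :=
      ENNReal.sum_ne_top.2 fun j _ => ENNReal.rpow_ne_top_of_nonneg hθ0.le (hfin j)
    have hle : S ≤ S ^ (1 / θ') * I := by
      have e1 : S = ∫⁻ x, ∑ j ∈ Finset.range N, (∫⁻ y, f j y ∂μ) ^ (θ - 1) * f j x ∂μ := by
        rw [lintegral_finsetSum _ fun j _ => (hf j).const_mul _]
        refine Finset.sum_congr rfl fun j _ => ?_
        rw [lintegral_const_mul _ (hf j)]
        conv_rhs => rw [← ENNReal.rpow_one (∫⁻ a, f j a ∂μ), ← ENNReal.rpow_mul, one_mul,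
          ← ENNReal.rpow_add_of_nonneg _ _ (by linarith) zero_le_one, sub_add_cancel]
      refine e1.le.trans ?_
      rw [hI, ← lintegral_const_mul _ (measurable_seqNorm θ hf)]
      refine lintegral_mono fun x => ?_
      refine (ENNReal.inner_le_Lp_mul_Lq (Finset.range N) _ _ hpq.symm).trans ?_
      refine mul_le_mul' (le_of_eq ?_) ?_
      · congr 1
        refine Finset.sum_congr rfl fun j _ => ?_
        rw [← ENNReal.rpow_mul, hpq.sub_one_mul_conj]
      · exact ENNReal.rpow_le_rpow (ENNReal.sum_le_tsum _) (one_div_nonneg.2 hθ0.le)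
    by_cases hS0 : S = 0
    · rw [hS0, ENNReal.zero_rpow_of_pos (one_div_pos.2 hθ0)]; exact zero_le
    have e3 : S ^ (1 / θ') * S ^ (1 / θ) = S := by
      have := hpq.inv_add_inv_eq_one
      rw [← ENNReal.rpow_add _ _ hS0 hStop, one_div, one_div, add_comm, this, ENNReal.rpow_one]
    have hne0 : S ^ (1 / θ') ≠ 0 := by simp [ENNReal.rpow_eq_zero_iff, hS0, hStop]
    have hnet : S ^ (1 / θ') ≠ ⊤ :=
      ENNReal.rpow_ne_top_of_nonneg (one_div_nonneg.2 hpq.symm.nonneg) hStop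
    have h4 : S ^ (1 / θ') * S ^ (1 / θ) ≤ S ^ (1 / θ') * I := by rw [e3]; exact hle
    exact (ENNReal.mul_le_mul_iff_right hne0 hnet).1 h4
  have hpow : ∑' j, (∫⁻ x, f j x ∂μ) ^ θ ≤ I ^ θ := by
    rw [ENNReal.tsum_eq_iSup_nat]
    refine iSup_le fun N => ?_
    have := ENNReal.rpow_le_rpow (hstep N) hθ0.le
    rwa [← ENNReal.rpow_mul, one_div_mul_cancel hθ0.ne', ENNReal.rpow_one] at this
  have := ENNReal.rpow_le_rpow hpow (one_div_nonneg.2 hθ0.le)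
  rwa [← ENNReal.rpow_mul, mul_one_div_cancel hθ0.ne', ENNReal.rpow_one] at this

/-! ### Nested partitions into cells of equal mass -/

/-- An increasing sequence of countable measurable partitions of `X`: the cells of level `i` are
the fibres of `idx i` and all have the same measure `mass i`. -/
structure CellFiltration (X ι : Type*) [MeasurableSpace X] [MeasurableSpace ι]
    (μ : Measure X) where
  idx : ℕ → X → ι
  measurable_idx : ∀ i, Measurable (idx i)
  nested : ∀ i x y, idx i x = idx i y → idx (i + 1) x = idx (i + 1) y
  mass : ℕ → ℝ≥0∞
  mass_ne_zero : ∀ i, mass i ≠ 0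
  mass_ne_top : ∀ i, mass i ≠ ⊤
  measure_fiber : ∀ i x, μ {y | idx i y = idx i x} = mass i

namespace CellFiltration

variable {X ι : Type*} [MeasurableSpace X] [MeasurableSpace ι] {μ : Measure X}
  (𝒞 : CellFiltration X ι μ)

/-- The cell of level `i` containing `x`. -/
def cell (i : ℕ) (x : X) : Set X := {y | 𝒞.idx i y = 𝒞.idx i x}

/-- The average of `F` over the cell of level `i` containing `x`. -/
def avg (i : ℕ) (F : X → ℝ≥0∞) (x : X) : ℝ≥0∞ := (∫⁻ y in 𝒞.cell i x, F y ∂μ) / 𝒞.mass i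

/-- The maximal function with weights `w` over the levels between `i` and `k`. -/
def maxFn (w : ℕ → ℝ≥0∞) (i k : ℕ) (F : X → ℝ≥0∞) (x : X) : ℝ≥0∞ :=
  ⨆ l ∈ Finset.Icc i k, w l * 𝒞.avg l F x

/-- A set is adapted at level `i` if it is a union of cells of level `i`. -/
def Adapted (i : ℕ) (D : Set X) : Prop := ∀ x y, 𝒞.idx i x = 𝒞.idx i y → x ∈ D → y ∈ D

variable {𝒞}

theorem mem_cell_self (i : ℕ) (x : X) : x ∈ 𝒞.cell i x := rfl

theorem measure_cell (i : ℕ) (x : X) : μ (𝒞.cell i x) = 𝒞.mass i := 𝒞.measure_fiber i x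

theorem cell_eq {i : ℕ} {x y : X} (h : 𝒞.idx i x = 𝒞.idx i y) : 𝒞.cell i x = 𝒞.cell i y := by
  unfold cell; rw [h]

theorem idx_eq_of_le {i k : ℕ} (hik : i ≤ k) {x y : X} (h : 𝒞.idx i x = 𝒞.idx i y) :
    𝒞.idx k x = 𝒞.idx k y := by
  induction hik with
  | refl => exact h
  | step _ ih => exact 𝒞.nested _ _ _ ih

theorem cell_subset {i k : ℕ} (hik : i ≤ k) (x : X) : 𝒞.cell i x ⊆ 𝒞.cell k x :=
  fun _ hy => idx_eq_of_le hik hy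

theorem mass_mono [Nonempty X] : Monotone 𝒞.mass := by
  intro i k hik
  obtain ⟨x⟩ := ‹Nonempty X›
  rw [← measure_cell i x, ← measure_cell k x]
  exact measure_mono (cell_subset hik x)

theorem avg_eq {i : ℕ} (F : X → ℝ≥0∞) {x y : X} (h : 𝒞.idx i x = 𝒞.idx i y) :
    𝒞.avg i F x = 𝒞.avg i F y := by
  unfold avg; rw [cell_eq h]

theorem maxFn_eq (w : ℕ → ℝ≥0∞) {i k : ℕ} (F : X → ℝ≥0∞) {x y : X}
    (h : 𝒞.idx i x = 𝒞.idx i y) : 𝒞.maxFn w i k F x = 𝒞.maxFn w i k F y := by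
  unfold maxFn
  refine iSup_congr fun l => iSup_congr fun hl => ?_
  rw [avg_eq F (idx_eq_of_le (Finset.mem_Icc.1 hl).1 h)]

theorem Adapted.mono {i k : ℕ} (hik : i ≤ k) {D : Set X} (hD : 𝒞.Adapted k D) :
    𝒞.Adapted i D := fun x y h => hD x y (idx_eq_of_le hik h)

theorem adapted_cell (i : ℕ) (x : X) : 𝒞.Adapted i (𝒞.cell i x) :=
  fun _ _ h hy => h.symm.trans hy

theorem Adapted.inter {i : ℕ} {D E : Set X} (hD : 𝒞.Adapted i D) (hE : 𝒞.Adapted i E) :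
    𝒞.Adapted i (D ∩ E) := fun x y h hx => ⟨hD x y h hx.1, hE x y h hx.2⟩

theorem Adapted.cell_subset {i : ℕ} {D : Set X} (hD : 𝒞.Adapted i D) {x : X} (hx : x ∈ D) :
    𝒞.cell i x ⊆ D := fun y hy => hD x y hy.symm hx

theorem maxFn_mono_Icc (w : ℕ → ℝ≥0∞) {i i' k k' : ℕ} (hi : i' ≤ i) (hk : k ≤ k')
    (F : X → ℝ≥0∞) (x : X) : 𝒞.maxFn w i k F x ≤ 𝒞.maxFn w i' k' F x :=
  biSup_mono fun _ hl => Finset.Icc_subset_Icc hi hk hl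

theorem le_maxFn (w : ℕ → ℝ≥0∞) {i k l : ℕ} (hil : i ≤ l) (hlk : l ≤ k) (F : X → ℝ≥0∞) (x : X) :
    w l * 𝒞.avg l F x ≤ 𝒞.maxFn w i k F x :=
  le_iSup₂ (f := fun l (_ : l ∈ Finset.Icc i k) => w l * 𝒞.avg l F x) l
    (Finset.mem_Icc.2 ⟨hil, hlk⟩)

theorem lt_maxFn_iff (w : ℕ → ℝ≥0∞) {i k : ℕ} (F : X → ℝ≥0∞) (x : X) (t : ℝ≥0∞) :
    t < 𝒞.maxFn w i k F x ↔ ∃ l ∈ Finset.Icc i k, t < w l * 𝒞.avg l F x := by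
  simp only [maxFn, lt_iSup_iff, exists_prop]

theorem maxFn_le_iff (w : ℕ → ℝ≥0∞) {i k : ℕ} (F : X → ℝ≥0∞) (x : X) (t : ℝ≥0∞) :
    𝒞.maxFn w i k F x ≤ t ↔ ∀ l ∈ Finset.Icc i k, w l * 𝒞.avg l F x ≤ t := by
  simp only [maxFn, iSup_le_iff]

theorem avg_mono {i : ℕ} {F G : X → ℝ≥0∞} {x : X} (h : ∀ y ∈ 𝒞.cell i x, F y ≤ G y)
    (hm : MeasurableSet (𝒞.cell i x)) : 𝒞.avg i F x ≤ 𝒞.avg i G x :=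
  ENNReal.div_le_div_right (setLIntegral_mono' hm h) _

theorem avg_const (i : ℕ) (c : ℝ≥0∞) (x : X) : 𝒞.avg i (fun _ => c) x = c := by
  rw [avg, setLIntegral_const, measure_cell,
    ENNReal.mul_div_cancel_right (𝒞.mass_ne_zero i) (𝒞.mass_ne_top i)]

theorem avg_add (i : ℕ) {F G : X → ℝ≥0∞} (hF : Measurable F) (x : X) :
    𝒞.avg i (fun y => F y + G y) x = 𝒞.avg i F x + 𝒞.avg i G x := by
  rw [avg, lintegral_add_left hF, avg, avg, ENNReal.add_div]

theorem maxFn_add_le (w : ℕ → ℝ≥0∞) (i k : ℕ) {F G : X → ℝ≥0∞} (hF : Measurable F) (x : X) :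
    𝒞.maxFn w i k (fun y => F y + G y) x ≤ 𝒞.maxFn w i k F x + 𝒞.maxFn w i k G x := by
  rw [maxFn_le_iff]
  intro l hl
  rw [avg_add l hF, mul_add]
  have := Finset.mem_Icc.1 hl
  exact add_le_add (le_maxFn w this.1 this.2 F x) (le_maxFn w this.1 this.2 G x)

theorem avg_le_of_mass_le {D : ℝ≥0∞} (hD : ∀ i, 𝒞.mass (i + 1) ≤ D * 𝒞.mass i) (i : ℕ)
    (F : X → ℝ≥0∞) (x : X) : 𝒞.avg i F x ≤ D * 𝒞.avg (i + 1) F x := by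
  unfold avg
  rw [ENNReal.div_le_iff (𝒞.mass_ne_zero i) (𝒞.mass_ne_top i)]
  calc ∫⁻ y in 𝒞.cell i x, F y ∂μ ≤ ∫⁻ y in 𝒞.cell (i + 1) x, F y ∂μ :=
        lintegral_mono_set (cell_subset (Nat.le_succ i) x)
    _ = (∫⁻ y in 𝒞.cell (i + 1) x, F y ∂μ) / 𝒞.mass (i + 1) * 𝒞.mass (i + 1) := by
        rw [ENNReal.div_mul_cancel (𝒞.mass_ne_zero _) (𝒞.mass_ne_top _)]
    _ ≤ (∫⁻ y in 𝒞.cell (i + 1) x, F y ∂μ) / 𝒞.mass (i + 1) * (D * 𝒞.mass i) := by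
        gcongr; exact hD i
    _ = _ := by ring

/-- Jensen's inequality for averages over cells. -/
theorem avg_rpow_le (i : ℕ) {F : X → ℝ≥0∞} (hF : Measurable F) {s : ℝ} (hs : 1 ≤ s) (x : X) :
    𝒞.avg i F x ^ s ≤ 𝒞.avg i (fun y => F y ^ s) x := by
  have hs0 : 0 < s := by linarith
  rcases hs.eq_or_lt with rfl | hs1
  · simp
  have hpq := Real.HolderConjugate.conjExponent hs1
  have h := ENNReal.lintegral_mul_le_Lp_mul_Lq (μ.restrict (𝒞.cell i x)) hpq
    hF.aemeasurable (aemeasurable_const (b := 1))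
  simp only [Pi.mul_apply, mul_one, ENNReal.one_rpow, setLIntegral_one, measure_cell] at h
  have h' := ENNReal.rpow_le_rpow h hs0.le
  rw [ENNReal.mul_rpow_of_nonneg _ _ hs0.le, ← ENNReal.rpow_mul, one_div_mul_cancel hs0.ne',
    ENNReal.rpow_one, ← ENNReal.rpow_mul] at h'
  unfold avg
  rw [ENNReal.div_rpow_of_nonneg _ _ hs0.le]
  have hm0 := 𝒞.mass_ne_zero i
  have hmt := 𝒞.mass_ne_top i
  rw [ENNReal.div_le_iff (by simp [ENNReal.rpow_eq_zero_iff, hm0, hmt])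
    (ENNReal.rpow_ne_top_of_nonneg hs0.le hmt)]
  refine h'.trans (le_of_eq ?_)
  have e : 1 / s.conjExponent * s = s - 1 := by
    rw [one_div, ← hpq.one_sub_inv]; field_simp
  rw [e, ENNReal.rpow_sub _ _ hm0 hmt, ENNReal.rpow_one, div_eq_mul_inv, div_eq_mul_inv]
  ring

theorem adapted_setOf {β : Type*} {i : ℕ} {φ : X → β}
    (hφ : ∀ x y, 𝒞.idx i x = 𝒞.idx i y → φ x = φ y) (P : β → Prop) :
    𝒞.Adapted i {x | P (φ x)} := fun x y h hx => by
  have hx' : P (φ x) := hx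
  rw [hφ x y h] at hx'
  exact hx'

section Countable

variable [Countable ι] [MeasurableSingletonClass ι]

theorem measurable_of_idx {β : Type*} [MeasurableSpace β] {i : ℕ} {φ : X → β}
    (h : ∀ x y, 𝒞.idx i x = 𝒞.idx i y → φ x = φ y) : Measurable φ := by
  rcases isEmpty_or_nonempty X with hX | ⟨⟨x₀⟩⟩
  · exact measurable_of_empty φ
  classical
  have : φ = (fun a => if hh : ∃ x, 𝒞.idx i x = a then φ hh.choose else φ x₀) ∘ 𝒞.idx i := by
    funext x
    have hh : ∃ z, 𝒞.idx i z = 𝒞.idx i x := ⟨x, rfl⟩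
    simp only [Function.comp_apply, hh, dite_true]
    exact (h _ _ hh.choose_spec).symm
  rw [this]
  exact (measurable_of_countable _).comp (𝒞.measurable_idx i)

theorem Adapted.measurableSet {i : ℕ} {D : Set X} (hD : 𝒞.Adapted i D) : MeasurableSet D := by
  have h : Measurable (fun x => x ∈ D) := measurable_of_idx (𝒞 := 𝒞) (i := i) fun x y hxy =>
    propext ⟨hD x y hxy, hD y x hxy.symm⟩
  exact measurableSet_setOfPred.2 h

theorem measurableSet_cell (i : ℕ) (x : X) : MeasurableSet (𝒞.cell i x) :=
  (adapted_cell i x).measurableSet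

theorem measurable_avg (i : ℕ) (F : X → ℝ≥0∞) : Measurable (𝒞.avg i F) :=
  measurable_of_idx fun _ _ h => avg_eq F h

theorem measurable_maxFn (w : ℕ → ℝ≥0∞) (i k : ℕ) (F : X → ℝ≥0∞) :
    Measurable (𝒞.maxFn w i k F) := measurable_of_idx fun _ _ h => maxFn_eq w F h

/-- Integrals over adapted sets may be compared cell by cell. -/
theorem setLIntegral_le_of_cell {i : ℕ} {D : Set X} (hD : 𝒞.Adapted i D) {F H : X → ℝ≥0∞}
    (h : ∀ x ∈ D, ∫⁻ y in 𝒞.cell i x, F y ∂μ ≤ ∫⁻ y in 𝒞.cell i x, H y ∂μ) :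
    ∫⁻ y in D, F y ∂μ ≤ ∫⁻ y in D, H y ∂μ := by
  have hU : D = ⋃ a : ι, D ∩ 𝒞.idx i ⁻¹' {a} := by
    ext x; simp
  have hm : ∀ a : ι, MeasurableSet (D ∩ 𝒞.idx i ⁻¹' {a}) := fun a =>
    hD.measurableSet.inter (𝒞.measurable_idx i (measurableSet_singleton a))
  have hd : Pairwise (Function.onFun Disjoint fun a : ι => D ∩ 𝒞.idx i ⁻¹' {a}) := by
    intro a b hab
    refine Set.disjoint_left.2 fun x hx hx' => hab ?_
    exact (hx.2 : 𝒞.idx i x = a).symm.trans hx'.2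
  rw [hU, lintegral_iUnion hm hd, lintegral_iUnion hm hd]
  refine ENNReal.tsum_le_tsum fun a => ?_
  rcases (D ∩ 𝒞.idx i ⁻¹' {a}).eq_empty_or_nonempty with he | ⟨x, hx⟩
  · rw [he]; simp
  · have : D ∩ 𝒞.idx i ⁻¹' {a} = 𝒞.cell i x := by
      have hxa : 𝒞.idx i x = a := hx.2
      ext y
      constructor
      · intro hy
        exact (hy.2 : 𝒞.idx i y = a).trans hxa.symm
      · intro hy
        exact ⟨hD.cell_subset hx.1 hy, (hy : 𝒞.idx i y = 𝒞.idx i x).trans hxa⟩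
    rw [this]
    exact h x hx.1

theorem setLIntegral_congr_of_cell {i : ℕ} {D : Set X} (hD : 𝒞.Adapted i D) {F H : X → ℝ≥0∞}
    (h : ∀ x ∈ D, ∫⁻ y in 𝒞.cell i x, F y ∂μ = ∫⁻ y in 𝒞.cell i x, H y ∂μ) :
    ∫⁻ y in D, F y ∂μ = ∫⁻ y in D, H y ∂μ :=
  le_antisymm (setLIntegral_le_of_cell hD fun x hx => (h x hx).le)
    (setLIntegral_le_of_cell hD fun x hx => (h x hx).ge)

/-- A function constant on the cells of level `i` may be multiplied with averages. -/
theorem setLIntegral_mul_avg {i : ℕ} {D : Set X} (hD : 𝒞.Adapted i D) {φ F : X → ℝ≥0∞}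
    (hφ : ∀ x y, 𝒞.idx i x = 𝒞.idx i y → φ x = φ y) (hF : Measurable F) :
    ∫⁻ y in D, φ y * 𝒞.avg i F y ∂μ = ∫⁻ y in D, φ y * F y ∂μ := by
  refine setLIntegral_congr_of_cell hD fun x _ => ?_
  have e1 : ∫⁻ y in 𝒞.cell i x, φ y * 𝒞.avg i F y ∂μ =
      ∫⁻ y in 𝒞.cell i x, φ x * 𝒞.avg i F x ∂μ :=
    setLIntegral_congr_fun (measurableSet_cell i x) fun y hy => by
      have hy' : 𝒞.idx i y = 𝒞.idx i x := hy
      simp only [hφ y x hy', avg_eq F hy']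
  have e2 : ∫⁻ y in 𝒞.cell i x, φ y * F y ∂μ = ∫⁻ y in 𝒞.cell i x, φ x * F y ∂μ :=
    setLIntegral_congr_fun (measurableSet_cell i x) fun y hy => by
      have hy' : 𝒞.idx i y = 𝒞.idx i x := hy
      simp only [hφ y x hy']
  rw [e1, e2, lintegral_const_mul _ hF, setLIntegral_const, measure_cell, mul_assoc, avg,
    ENNReal.div_mul_cancel (𝒞.mass_ne_zero i) (𝒞.mass_ne_top i)]

theorem setLIntegral_avg {i : ℕ} {D : Set X} (hD : 𝒞.Adapted i D) {F : X → ℝ≥0∞}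
    (hF : Measurable F) : ∫⁻ y in D, 𝒞.avg i F y ∂μ = ∫⁻ y in D, F y ∂μ := by
  simpa using setLIntegral_mul_avg hD (φ := fun _ => 1) (fun _ _ _ => rfl) hF

/-- The weak type inequality for the maximal function. -/
theorem mul_measure_maxFn_le (t : ℝ≥0∞) {F : X → ℝ≥0∞} (hF : Measurable F) (k : ℕ) {D : Set X}
    (hD : 𝒞.Adapted k D) :
    t * μ (D ∩ {x | t < 𝒞.maxFn 1 0 k F x}) ≤ ∫⁻ x in D ∩ {x | t < 𝒞.maxFn 1 0 k F x}, F x ∂μ := by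
  have top : ∀ (k : ℕ) (D : Set X), 𝒞.Adapted k D → (∀ x ∈ D, t < 𝒞.avg k F x) →
      t * μ D ≤ ∫⁻ x in D, F x ∂μ := by
    intro k D hD h
    rw [← setLIntegral_avg hD hF, ← setLIntegral_const]
    exact setLIntegral_mono' hD.measurableSet fun x hx => (h x hx).le
  induction k generalizing D with
  | zero =>
    refine top 0 _ (hD.inter (adapted_setOf (fun x y h => maxFn_eq 1 F h) (fun a => t < a))) ?_
    rintro x ⟨_, hx⟩
    obtain ⟨l, hl, hlt⟩ := (lt_maxFn_iff _ _ _ _).1 hx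
    simp only [Finset.Icc_self, Finset.mem_singleton] at hl
    subst hl
    simpa using hlt
  | succ k ih =>
    set E := {x | t < 𝒞.avg (k + 1) F x} with hE
    have hEa : 𝒞.Adapted (k + 1) E := adapted_setOf (fun x y h => avg_eq F h) (fun a => t < a)
    have hEc : 𝒞.Adapted (k + 1) Eᶜ := fun x y h hx hy => hx (hEa y x h.symm hy)
    have hsplit : D ∩ {x | t < 𝒞.maxFn 1 0 (k + 1) F x} =
        (D ∩ E) ∪ ((D ∩ Eᶜ) ∩ {x | t < 𝒞.maxFn 1 0 k F x}) := by
      ext x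
      constructor
      · rintro ⟨hxD, hx⟩
        by_cases hxE : x ∈ E
        · exact Or.inl ⟨hxD, hxE⟩
        · refine Or.inr ⟨⟨hxD, hxE⟩, ?_⟩
          obtain ⟨l, hl, hlt⟩ := (lt_maxFn_iff _ _ _ _).1 hx
          refine (lt_maxFn_iff _ _ _ _).2 ⟨l, ?_, hlt⟩
          rw [Finset.mem_Icc] at hl ⊢
          rcases hl.2.eq_or_lt with h | h
          · subst h
            exact absurd (show t < 𝒞.avg (k + 1) F x by simpa using hlt) hxE
          · exact ⟨hl.1, Nat.lt_succ_iff.1 h⟩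
      · rintro (⟨hxD, hx⟩ | ⟨⟨hxD, _⟩, hx⟩)
        · refine ⟨hxD, lt_of_lt_of_le (b := 𝒞.avg (k + 1) F x) hx ?_⟩
          simpa using le_maxFn (𝒞 := 𝒞) 1 (Nat.zero_le (k + 1)) le_rfl F x
        · exact ⟨hxD, lt_of_lt_of_le hx (maxFn_mono_Icc 1 le_rfl (Nat.le_succ k) F x)⟩
    have hm : MeasurableSet ((D ∩ Eᶜ) ∩ {x | t < 𝒞.maxFn 1 0 k F x}) :=
      (hD.inter hEc).measurableSet.inter
        (measurableSet_lt measurable_const (measurable_maxFn _ _ _ _))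
    have hdisj : Disjoint (D ∩ E) ((D ∩ Eᶜ) ∩ {x | t < 𝒞.maxFn 1 0 k F x}) :=
      Set.disjoint_left.2 fun x hx hx' => hx'.1.2 hx.2
    rw [hsplit, measure_union hdisj hm, lintegral_union hm hdisj, mul_add]
    exact add_le_add (top _ _ (hD.inter hEa) fun x hx => hx.2)
      (ih ((hD.inter hEc).mono (Nat.le_succ k)))

/-- Doob's maximal inequality. -/
theorem setLIntegral_maxFn_rpow_le [SFinite μ] {F : X → ℝ≥0∞} (hF : Measurable F) {s : ℝ}
    (hs : 1 < s) (k : ℕ) {D : Set X} (hD : 𝒞.Adapted k D) :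
    ∫⁻ x in D, 𝒞.maxFn 1 0 k F x ^ s ∂μ ≤
      ENNReal.ofReal (2 ^ s * s / (s - 1)) * ∫⁻ x in D, F x ^ s ∂μ := by
  refine lintegral_rpow_le_of_weak (measurable_maxFn _ _ _ _) hF hs fun t ht => ?_
  have ht0 : ENNReal.ofReal t ≠ 0 := by simpa using ht
  set τ := ENNReal.ofReal t
  have hτ : τ ≠ ⊤ := ENNReal.ofReal_ne_top
  set E := {x | τ < 2 * F x}
  have hE : MeasurableSet E := measurableSet_lt measurable_const (by fun_prop)
  set F' := E.indicator F
  have hF' : Measurable F' := hF.indicator hE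
  have hle : ∀ x, 𝒞.maxFn 1 0 k F x ≤ 𝒞.maxFn 1 0 k F' x + τ / 2 := by
    intro x
    rw [maxFn_le_iff]
    intro l hl
    have hl' := Finset.mem_Icc.1 hl
    have h1 : 𝒞.avg l F x ≤ 𝒞.avg l (fun y => F' y + τ / 2) x := by
      refine avg_mono (fun y _ => ?_) (measurableSet_cell l x)
      by_cases hy : y ∈ E
      · simp [F', hy]
      · have : 2 * F y ≤ τ := not_lt.1 hy
        simp only [F', Set.indicator_of_notMem hy, zero_add]
        rw [ENNReal.le_div_iff_mul_le (by simp) (by simp), mul_comm]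
        exact this
    rw [avg_add l hF', avg_const] at h1
    have h2 := le_maxFn (𝒞 := 𝒞) 1 hl'.1 hl'.2 F' x
    simp only [Pi.one_apply, one_mul] at h2 ⊢
    exact h1.trans (add_le_add h2 le_rfl)
  have hsub : {x | τ < 𝒞.maxFn 1 0 k F x} ⊆ {x | τ / 2 < 𝒞.maxFn 1 0 k F' x} := by
    intro x hx
    by_contra hcon
    have hcon' : 𝒞.maxFn 1 0 k F' x ≤ τ / 2 := not_lt.1 hcon
    have : 𝒞.maxFn 1 0 k F x ≤ τ :=
      (hle x).trans ((add_le_add hcon' le_rfl).trans (ENNReal.add_halves τ).le)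
    exact absurd (hx : τ < _) (not_lt.2 this)
  have hw := mul_measure_maxFn_le (𝒞 := 𝒞) (τ / 2) hF' k hD
  have hmE : MeasurableSet {x | τ < 𝒞.maxFn 1 0 k F x} :=
    measurableSet_lt measurable_const (measurable_maxFn _ _ _ _)
  calc τ * μ.restrict D {x | τ < 𝒞.maxFn 1 0 k F x}
      = 2 * (τ / 2 * μ (D ∩ {x | τ < 𝒞.maxFn 1 0 k F x})) := by
        rw [Measure.restrict_apply hmE, Set.inter_comm, ← mul_assoc,
          ENNReal.mul_div_cancel two_ne_zero ENNReal.ofNat_ne_top]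
    _ ≤ 2 * (τ / 2 * μ (D ∩ {x | τ / 2 < 𝒞.maxFn 1 0 k F' x})) := by gcongr
    _ ≤ 2 * ∫⁻ x in D ∩ {x | τ / 2 < 𝒞.maxFn 1 0 k F' x}, F' x ∂μ := by gcongr
    _ ≤ 2 * ∫⁻ x in D, F' x ∂μ := by
        gcongr
        exact Set.inter_subset_left
    _ = _ := by rw [lintegral_indicator hE]

end Countable

end CellFiltration

/-! ### The vector-valued maximal function -/

namespace CellFiltration

variable {X ι : Type*} [MeasurableSpace X] [MeasurableSpace ι] {μ : Measure X}
  {𝒞 : CellFiltration X ι μ}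

variable (𝒞) in
/-- The averages of `f`, stopped at the coarsest cell of level at most `k` on which the average of
`g` exceeds `t`. -/
def stoppedAvg (t : ℝ≥0∞) (g : X → ℝ≥0∞) : ℕ → (X → ℝ≥0∞) → X → ℝ≥0∞
  | 0, f => 𝒞.avg 0 f
  | k + 1, f => fun x => if t < 𝒞.avg (k + 1) g x then 𝒞.avg (k + 1) f x else stoppedAvg t g k f x

theorem stoppedAvg_of_lt {t : ℝ≥0∞} {g : X → ℝ≥0∞} {k : ℕ} {x : X} (h : t < 𝒞.avg k g x)
    (f : X → ℝ≥0∞) : 𝒞.stoppedAvg t g k f x = 𝒞.avg k f x := by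
  cases k with
  | zero => rfl
  | succ k => simp only [stoppedAvg, h, if_true]

theorem stoppedAvg_succ_of_le {t : ℝ≥0∞} {g : X → ℝ≥0∞} {k : ℕ} {x : X}
    (h : 𝒞.avg (k + 1) g x ≤ t) (f : X → ℝ≥0∞) :
    𝒞.stoppedAvg t g (k + 1) f x = 𝒞.stoppedAvg t g k f x := by
  simp only [stoppedAvg, not_lt.2 h, if_false]

theorem stoppedAvg_eq (t : ℝ≥0∞) (g : X → ℝ≥0∞) (k : ℕ) (f : X → ℝ≥0∞) {x y : X}
    (h : 𝒞.idx 0 x = 𝒞.idx 0 y) : 𝒞.stoppedAvg t g k f x = 𝒞.stoppedAvg t g k f y := by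
  induction k with
  | zero => exact avg_eq f h
  | succ k ih =>
    have h' := idx_eq_of_le (Nat.zero_le (k + 1)) h
    simp only [stoppedAvg, avg_eq f h', avg_eq g h', ih]

theorem stoppedAvg_eq_of_le {t : ℝ≥0∞} {g : X → ℝ≥0∞} {i k : ℕ} (hik : i ≤ k) {x : X}
    (h : ∀ l, i < l → l ≤ k → 𝒞.avg l g x ≤ t) (f : X → ℝ≥0∞) :
    𝒞.stoppedAvg t g k f x = 𝒞.stoppedAvg t g i f x := by
  induction hik with
  | refl => rfl
  | step hm ih =>
    rename_i m
    rw [stoppedAvg_succ_of_le (h (m + 1) (Nat.lt_succ_of_le hm) le_rfl)]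
    exact ih fun l h1 h2 => h l h1 (h2.trans (Nat.le_succ m))

theorem seqNorm_avg_le {θ : ℝ} (hθ : 1 < θ) {f : ℕ → X → ℝ≥0∞} (hf : ∀ j, Measurable (f j))
    (i : ℕ) (x : X) :
    seqNorm θ (fun j => 𝒞.avg i (f j) x) ≤ 𝒞.avg i (fun y => seqNorm θ fun j => f j y) x := by
  have h := seqNorm_lintegral_le (μ := μ.restrict (𝒞.cell i x)) hθ hf
  have e : (fun j => 𝒞.avg i (f j) x) =
      fun j => (𝒞.mass i)⁻¹ * ∫⁻ y in 𝒞.cell i x, f j y ∂μ := by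
    funext j; rw [avg, div_eq_mul_inv, mul_comm]
  rw [e, seqNorm_const_mul (by linarith), avg, div_eq_mul_inv, mul_comm]
  gcongr

theorem seqNorm_stoppedAvg_le {θ : ℝ} (hθ : 1 < θ) {f : ℕ → X → ℝ≥0∞}
    (hf : ∀ j, Measurable (f j)) {D : ℝ≥0∞} (hD1 : 1 ≤ D)
    (hD : ∀ i, 𝒞.mass (i + 1) ≤ D * 𝒞.mass i) {t : ℝ≥0∞} (k : ℕ) {x : X}
    (h : 𝒞.avg k (fun y => seqNorm θ fun j => f j y) x ≤ t) :
    seqNorm θ (fun j => 𝒞.stoppedAvg t (fun y => seqNorm θ fun j => f j y) k (f j) x) ≤ D * t := by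
  induction k with
  | zero =>
    exact (seqNorm_avg_le hθ hf 0 x).trans (h.trans (le_mul_of_one_le_left zero_le hD1))
  | succ k ih =>
    simp_rw [stoppedAvg_succ_of_le h]
    by_cases hk : t < 𝒞.avg k (fun y => seqNorm θ fun j => f j y) x
    · simp_rw [stoppedAvg_of_lt hk]
      refine (seqNorm_avg_le hθ hf k x).trans ((avg_le_of_mass_le hD k _ x).trans ?_)
      gcongr
    · exact ih (not_lt.1 hk)

section Countable

variable [Countable ι] [MeasurableSingletonClass ι]

theorem measurable_stoppedAvg (t : ℝ≥0∞) (g : X → ℝ≥0∞) (k : ℕ) (f : X → ℝ≥0∞) :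
    Measurable (𝒞.stoppedAvg t g k f) :=
  measurable_of_idx fun _ _ h => stoppedAvg_eq t g k f h

theorem avg_stoppedAvg (t : ℝ≥0∞) (g : X → ℝ≥0∞) (k : ℕ) {f : X → ℝ≥0∞} (hf : Measurable f)
    (x : X) : 𝒞.avg k (𝒞.stoppedAvg t g k f) x = 𝒞.avg k f x := by
  induction k generalizing x with
  | zero =>
    simp only [avg, stoppedAvg]
    rw [← setLIntegral_avg (adapted_cell 0 x) hf]
    rfl
  | succ k ih =>
    by_cases h : t < 𝒞.avg (k + 1) g x
    · unfold avg
      congr 1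
      rw [← setLIntegral_avg (adapted_cell (k + 1) x) hf]
      refine setLIntegral_congr_fun (measurableSet_cell _ x) fun y hy => ?_
      exact stoppedAvg_of_lt (by rwa [avg_eq g hy]) f
    · unfold avg
      congr 1
      have e : ∫⁻ y in 𝒞.cell (k + 1) x, 𝒞.stoppedAvg t g (k + 1) f y ∂μ =
          ∫⁻ y in 𝒞.cell (k + 1) x, 𝒞.stoppedAvg t g k f y ∂μ := by
        refine setLIntegral_congr_fun (measurableSet_cell _ x) fun y hy => ?_
        exact stoppedAvg_succ_of_le (by rw [avg_eq g hy]; exact not_lt.1 h) f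
      rw [e]
      refine setLIntegral_congr_of_cell ((adapted_cell (k + 1) x).mono (Nat.le_succ k))
        fun z _ => ?_
      have := ih z
      unfold avg at this
      rw [ENNReal.div_eq_div_iff (𝒞.mass_ne_zero k) (𝒞.mass_ne_top k) (𝒞.mass_ne_zero k)
        (𝒞.mass_ne_top k)] at this
      exact (ENNReal.mul_right_inj (𝒞.mass_ne_zero k) (𝒞.mass_ne_top k)).1 this

theorem maxFn_stoppedAvg {t : ℝ≥0∞} {g : X → ℝ≥0∞} {k : ℕ} {f : X → ℝ≥0∞} (hf : Measurable f)
    {x : X} (h : ∀ l ≤ k, 𝒞.avg l g x ≤ t) :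
    𝒞.maxFn 1 0 k (𝒞.stoppedAvg t g k f) x = 𝒞.maxFn 1 0 k f x := by
  refine iSup_congr fun i => iSup_congr fun hi => ?_
  have hik := (Finset.mem_Icc.1 hi).2
  rw [← avg_stoppedAvg t g i hf x]
  congr 1
  unfold avg
  congr 1
  refine setLIntegral_congr_fun (measurableSet_cell _ x) fun y hy => ?_
  refine stoppedAvg_eq_of_le hik (fun l h1 h2 => ?_) f
  rw [avg_eq g (idx_eq_of_le h1.le hy)]
  exact h l h2

end Countable

/-- The constant in the local weak type inequality for the vector-valued maximal function. -/
def vectorWeakConst (D : ℝ≥0∞) (θ : ℝ) : ℝ≥0∞ :=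
  4 * ENNReal.ofReal (2 ^ θ * θ / (θ - 1)) * (4 * D)

theorem one_le_doobConst {θ : ℝ} (hθ : 1 < θ) : 1 ≤ ENNReal.ofReal (2 ^ θ * θ / (θ - 1)) := by
  rw [ENNReal.one_le_ofReal, le_div_iff₀ (by linarith), one_mul]
  have : (1 : ℝ) ≤ 2 ^ θ := Real.one_le_rpow one_le_two (by linarith)
  nlinarith

theorem one_le_vectorWeakConst {D : ℝ≥0∞} (hD1 : 1 ≤ D) {θ : ℝ} (hθ : 1 < θ) :
    1 ≤ vectorWeakConst D θ := by
  have h4 : (1 : ℝ≥0∞) ≤ 4 := by norm_num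
  exact one_le_mul (one_le_mul h4 (one_le_doobConst hθ)) (one_le_mul h4 hD1)

theorem vectorWeakConst_ne_top {D : ℝ≥0∞} (hD : D ≠ ⊤) (θ : ℝ) : vectorWeakConst D θ ≠ ⊤ :=
  ENNReal.mul_ne_top (ENNReal.mul_ne_top (by simp) ENNReal.ofReal_ne_top)
    (ENNReal.mul_ne_top (by simp) hD)

variable [Countable ι] [MeasurableSingletonClass ι] [SFinite μ]

/-- On a cell, the vector-valued maximal function exceeds a large multiple of the average of the
`ℓ^θ` norm on at most half of the cell. -/
theorem measure_cell_inter_seqNorm_maxFn_le {θ : ℝ} (hθ : 1 < θ) {f : ℕ → X → ℝ≥0∞}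
    (hf : ∀ j, Measurable (f j)) {D : ℝ≥0∞} (hD1 : 1 ≤ D) (hDtop : D ≠ ⊤)
    (hD : ∀ i, 𝒞.mass (i + 1) ≤ D * 𝒞.mass i) (k : ℕ) (x : X) :
    μ (𝒞.cell k x ∩ {y | vectorWeakConst D θ * 𝒞.avg k (fun y => seqNorm θ fun j => f j y) x <
      seqNorm θ fun j => 𝒞.maxFn 1 0 k (f j) y}) ≤ 𝒞.mass k / 2 := by
  have hθ0 : 0 < θ := by linarith
  set g : X → ℝ≥0∞ := fun y => seqNorm θ fun j => f j y with hg
  have hgm : Measurable g := measurable_seqNorm θ hf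
  set A := vectorWeakConst D θ with hA
  set a := 𝒞.avg k g x with ha
  have hA1 : 1 ≤ A := one_le_vectorWeakConst hD1 hθ
  have hA0 : A ≠ 0 := (zero_lt_one.trans_le hA1).ne'
  have hm0 := 𝒞.mass_ne_zero k
  have hmt := 𝒞.mass_ne_top k
  have hmass : ∫⁻ y in 𝒞.cell k x, g y ∂μ = a * 𝒞.mass k := by
    rw [ha, avg, ENNReal.div_mul_cancel hm0 hmt]
  by_cases hat : a = ⊤
  · rw [hat, ENNReal.mul_top hA0]; simp
  by_cases ha0 : a = 0
  · have hzero : ∀ y ∈ 𝒞.cell k x, ∀ j, 𝒞.maxFn 1 0 k (f j) y = 0 := by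
      intro y hy j
      refine le_antisymm ((maxFn_le_iff _ _ _ _).2 fun l hl => ?_) zero_le
      have hlk := (Finset.mem_Icc.1 hl).2
      have : ∫⁻ z in 𝒞.cell l y, f j z ∂μ ≤ 0 :=
        calc ∫⁻ z in 𝒞.cell l y, f j z ∂μ ≤ ∫⁻ z in 𝒞.cell l y, g z ∂μ :=
              lintegral_mono fun z => le_seqNorm hθ0 (fun j => f j z) j
          _ ≤ ∫⁻ z in 𝒞.cell k x, g z ∂μ :=
              lintegral_mono_set ((cell_subset hlk y).trans (cell_eq hy).subset)
          _ = 0 := by rw [hmass, ha0, zero_mul]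
      simp [avg, le_antisymm this zero_le]
    have hempty : 𝒞.cell k x ∩ {y | A * a < seqNorm θ fun j => 𝒞.maxFn 1 0 k (f j) y} = ∅ := by
      refine Set.eq_empty_of_forall_notMem fun y hy => ?_
      have h2 : A * a < seqNorm θ fun j => 𝒞.maxFn 1 0 k (f j) y := hy.2
      simp [hzero y hy.1, seqNorm, hθ0] at h2
    rw [hempty]; simp
  set t := 4 * a with ht
  have ht0 : t ≠ 0 := mul_ne_zero (by simp) ha0
  have htt : t ≠ ⊤ := ENNReal.mul_ne_top (by simp) hat
  set Ω := 𝒞.cell k x ∩ {y | t < 𝒞.maxFn 1 0 k g y} with hΩ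
  have hΩle : μ Ω ≤ 𝒞.mass k / 4 := by
    have h1 : t * μ Ω ≤ a * 𝒞.mass k := by
      rw [← hmass]
      exact (mul_measure_maxFn_le t hgm k (adapted_cell k x)).trans
        (lintegral_mono_set Set.inter_subset_left)
    rw [ENNReal.le_div_iff_mul_le (by simp) (by simp)]
    rw [ht, mul_comm 4 a, mul_assoc] at h1
    rw [mul_comm]
    exact (ENNReal.mul_le_mul_iff_right ha0 hat).1 h1
  set T : ℕ → X → ℝ≥0∞ := fun j => 𝒞.stoppedAvg t g k (f j) with hT
  have hTm : ∀ j, Measurable (T j) := fun j => measurable_stoppedAvg t g k (f j)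
  set U : X → ℝ≥0∞ := fun y => seqNorm θ fun j => 𝒞.maxFn 1 0 k (T j) y with hU
  have hUm : Measurable U := measurable_seqNorm θ fun j => measurable_maxFn _ _ _ _
  set S := 𝒞.cell k x ∩ {y | A * a < U y} with hS
  set Cθ := ENNReal.ofReal (2 ^ θ * θ / (θ - 1)) with hCθ
  have hC1 : 1 ≤ Cθ := one_le_doobConst hθ
  have hCt : Cθ ≠ ⊤ := ENNReal.ofReal_ne_top
  have hUint : ∫⁻ y in 𝒞.cell k x, U y ^ θ ∂μ ≤ Cθ * ((D * t) ^ θ * 𝒞.mass k) := by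
    calc ∫⁻ y in 𝒞.cell k x, U y ^ θ ∂μ
        = ∑' j, ∫⁻ y in 𝒞.cell k x, 𝒞.maxFn 1 0 k (T j) y ^ θ ∂μ := by
          simp_rw [hU, seqNorm_rpow hθ0]
          exact lintegral_tsum fun j => ((measurable_maxFn _ _ _ _).pow_const θ).aemeasurable
      _ ≤ ∑' j, Cθ * ∫⁻ y in 𝒞.cell k x, T j y ^ θ ∂μ :=
          ENNReal.tsum_le_tsum fun j => setLIntegral_maxFn_rpow_le (hTm j) hθ k (adapted_cell k x)
      _ = Cθ * ∫⁻ y in 𝒞.cell k x, seqNorm θ (fun j => T j y) ^ θ ∂μ := by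
          rw [ENNReal.tsum_mul_left]
          simp_rw [seqNorm_rpow hθ0]
          rw [lintegral_tsum fun j => ((hTm j).pow_const θ).aemeasurable]
      _ ≤ Cθ * ∫⁻ _ in 𝒞.cell k x, (D * t) ^ θ ∂μ := by
          refine mul_le_mul' le_rfl (setLIntegral_mono' (measurableSet_cell k x) fun y hy => ?_)
          refine ENNReal.rpow_le_rpow (seqNorm_stoppedAvg_le hθ hf hD1 hD k ?_) hθ0.le
          rw [← hg, avg_eq g hy, ht]
          exact le_mul_of_one_le_left zero_le (by norm_num)
      _ = _ := by rw [setLIntegral_const, measure_cell]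
  have hSle : μ S ≤ 𝒞.mass k / 4 := by
    set B := Cθ * (D * t) ^ θ with hB
    have hB0 : B ≠ 0 := by
      refine mul_ne_zero (zero_lt_one.trans_le hC1).ne' ?_
      have hDt : D * t ≠ 0 := mul_ne_zero (zero_lt_one.trans_le hD1).ne' ht0
      simp [ENNReal.rpow_eq_zero_iff, hDt, hθ0.le]
    have hBt : B ≠ ⊤ := ENNReal.mul_ne_top hCt
      (ENNReal.rpow_ne_top_of_nonneg hθ0.le (ENNReal.mul_ne_top hDtop htt))
    have hlow : 4 * B ≤ (A * a) ^ θ := by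
      have : A * a = 4 * Cθ * (D * t) := by
        rw [hA, vectorWeakConst, ht]; ring
      rw [this, ENNReal.mul_rpow_of_nonneg _ _ hθ0.le, hB, ← mul_assoc]
      gcongr
      have h4 : (1 : ℝ≥0∞) ≤ 4 * Cθ := one_le_mul (by norm_num) hC1
      calc 4 * Cθ = (4 * Cθ) ^ (1 : ℝ) := (ENNReal.rpow_one _).symm
        _ ≤ _ := ENNReal.rpow_le_rpow_of_exponent_le h4 hθ.le
    have hch : 4 * B * μ S ≤ B * 𝒞.mass k := by
      calc 4 * B * μ S ≤ (A * a) ^ θ * μ S := by gcongr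
        _ = ∫⁻ _ in S, (A * a) ^ θ ∂μ := (setLIntegral_const _ _).symm
        _ ≤ ∫⁻ y in S, U y ^ θ ∂μ := by
            refine setLIntegral_mono' ((measurableSet_cell k x).inter
              (measurableSet_lt measurable_const hUm)) fun y hy => ?_
            exact ENNReal.rpow_le_rpow (show A * a < U y from hy.2).le hθ0.le
        _ ≤ ∫⁻ y in 𝒞.cell k x, U y ^ θ ∂μ := lintegral_mono_set Set.inter_subset_left
        _ ≤ _ := by rw [hB, mul_assoc]; exact hUint
    rw [ENNReal.le_div_iff_mul_le (by simp) (by simp)]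
    rw [mul_comm 4 B, mul_assoc] at hch
    rw [mul_comm]
    exact (ENNReal.mul_le_mul_iff_right hB0 hBt).1 hch
  have hsub : 𝒞.cell k x ∩ {y | A * a < seqNorm θ fun j => 𝒞.maxFn 1 0 k (f j) y} ⊆ Ω ∪ S := by
    rintro y ⟨hyc, hy⟩
    by_cases hyΩ : t < 𝒞.maxFn 1 0 k g y
    · exact Or.inl ⟨hyc, hyΩ⟩
    · refine Or.inr ⟨hyc, ?_⟩
      have hle : ∀ l ≤ k, 𝒞.avg l g y ≤ t := fun l hl => by
        have := (maxFn_le_iff _ _ _ _).1 (not_lt.1 hyΩ) l (Finset.mem_Icc.2 ⟨Nat.zero_le l, hl⟩)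
        simpa using this
      change A * a < seqNorm θ fun j => 𝒞.maxFn 1 0 k (T j) y
      simp_rw [hT, maxFn_stoppedAvg (hf _) hle]
      exact hy
  calc _ ≤ μ (Ω ∪ S) := measure_mono hsub
    _ ≤ μ Ω + μ S := measure_union_le _ _
    _ ≤ 𝒞.mass k / 4 + 𝒞.mass k / 4 := add_le_add hΩle hSle
    _ = 𝒞.mass k / 2 := by
      rw [← two_mul, ← mul_div_assoc, show (4 : ℝ≥0∞) = 2 * 2 by norm_num,
        ENNReal.mul_div_mul_left _ _ (by simp) (by simp)]

/-- The bilinear estimate for the vector-valued maximal function. -/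
theorem setLIntegral_seqNorm_maxFn_mul_le {θ : ℝ} (hθ : 1 < θ) {f : ℕ → X → ℝ≥0∞}
    (hf : ∀ j, Measurable (f j)) {D : ℝ≥0∞} (hD1 : 1 ≤ D) (hDtop : D ≠ ⊤)
    (hD : ∀ i, 𝒞.mass (i + 1) ≤ D * 𝒞.mass i) {w : ℕ → ℝ≥0∞} (hw : Monotone w)
    {h : X → ℝ≥0∞} (hh : Measurable h) (k : ℕ) {S : Set X} (hS : 𝒞.Adapted k S) :
    ∫⁻ x in S, (seqNorm θ fun j => 𝒞.maxFn w 0 k (f j) x) * h x ∂μ ≤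
      2 * vectorWeakConst D θ * ∫⁻ x in S,
        𝒞.maxFn w 0 k (fun y => seqNorm θ fun j => f j y) x * 𝒞.maxFn 1 0 k h x ∂μ := by
  have hθ0 : 0 < θ := by linarith
  set g : X → ℝ≥0∞ := fun y => seqNorm θ fun j => f j y with hg
  have hgm : Measurable g := measurable_seqNorm θ hf
  set A := vectorWeakConst D θ with hA
  have hA1 : 1 ≤ A := one_le_vectorWeakConst hD1 hθ
  induction k using Nat.strong_induction_on generalizing S with
  | _ k ih =>
    set a : X → ℝ≥0∞ := fun y => A * 𝒞.avg k g y with ha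
    set G : ℕ → X → ℝ≥0∞ := fun i y => seqNorm θ fun j => 𝒞.maxFn 1 i k (f j) y with hG
    set V : ℕ → X → ℝ≥0∞ := fun i y => seqNorm θ fun j => 𝒞.maxFn w 0 i (f j) y with hV
    have hVm : ∀ i, Measurable (V i) := fun i =>
      measurable_seqNorm θ fun j => measurable_maxFn _ _ _ _
    have haeq : ∀ x y, 𝒞.idx k x = 𝒞.idx k y → a x = a y := fun x y hxy => by
      simp only [ha, avg_eq g hxy]
    have hGeq : ∀ i x y, 𝒞.idx i x = 𝒞.idx i y → G i x = G i y := fun i x y hxy => by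
      simp only [hG, maxFn_eq 1 _ hxy]
    have hGanti : ∀ i i' y, i ≤ i' → G i' y ≤ G i y := fun i i' y hi =>
      seqNorm_mono hθ0 fun j => maxFn_mono_Icc 1 hi le_rfl _ _
    have hGk : ∀ y, G k y ≤ a y := by
      intro y
      have h1 : G k y = seqNorm θ fun j => 𝒞.avg k (f j) y := by
        simp only [hG, maxFn, Finset.Icc_self, Finset.mem_singleton, iSup_iSup_eq_left,
          Pi.one_apply, one_mul]
      rw [h1]
      exact (seqNorm_avg_le hθ hf k y).trans (le_mul_of_one_le_left zero_le hA1)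
    set Ω : Set X := {y | a y < G 0 y} with hΩ
    have hΩm : MeasurableSet Ω := by
      refine measurableSet_lt ((measurable_avg k g).const_mul A) ?_
      exact measurable_seqNorm θ fun j => measurable_maxFn _ _ _ _
    set E : ℕ → Set X := fun i => S ∩ {y | a y < G i y ∧ G (i + 1) y ≤ a y} with hE
    have hEa : ∀ i < k, 𝒞.Adapted i (E i) := by
      intro i hi x y hxy hx
      refine ⟨(hS.mono hi.le) x y hxy hx.1, ?_⟩
      have h2 : a x < G i x ∧ G (i + 1) x ≤ a x := hx.2
      rw [haeq x y (idx_eq_of_le hi.le hxy), hGeq i x y hxy,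
        hGeq (i + 1) x y (idx_eq_of_le (Nat.le_succ i) hxy)] at h2
      exact h2
    have hEex : ∀ y ∈ S, y ∈ Ω → ∃ i < k, y ∈ E i := by
      intro y hyS hyΩ
      by_contra hcon
      have hall : ∀ i ≤ k, a y < G i y := by
        intro i
        induction i with
        | zero => exact fun _ => hyΩ
        | succ i ihi =>
          intro hik
          by_contra hle
          exact hcon ⟨i, hik, hyS, ihi (Nat.le_of_succ_le hik), not_lt.1 hle⟩
      exact absurd (hall k le_rfl) (not_lt.2 (hGk y))
    have hEd : ∀ i i', i < i' → Disjoint (E i) (E i') := by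
      intro i i' hii'
      refine Set.disjoint_left.2 fun y hy hy' => ?_
      have h1 : G (i + 1) y ≤ a y := hy.2.2
      have h2 : a y < G i' y := hy'.2.1
      exact absurd (h2.trans_le (hGanti (i + 1) i' y hii')) (not_lt.2 h1)
    have hEpd : Set.PairwiseDisjoint (↑(Finset.range k)) E := by
      intro i _ i' _ hne
      rcases lt_or_gt_of_ne hne with hlt | hlt
      · exact hEd i i' hlt
      · exact (hEd i' i hlt).symm
    have hEΩ : ∀ i, E i ⊆ Ω := fun i y hy =>
      lt_of_lt_of_le (show a y < G i y from hy.2.1) (hGanti 0 i y (Nat.zero_le i))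
    have hpt : ∀ y ∈ S, V k y * h y ≤ w k * a y * h y +
        ∑ i ∈ Finset.range k, (E i).indicator (fun y => V i y * h y) y := by
      intro y hyS
      by_cases hyΩ : y ∈ Ω
      · obtain ⟨i, hik, hyE⟩ := hEex y hyS hyΩ
        have h1 : V k y ≤ w k * a y + V i y := by
          calc V k y ≤ seqNorm θ fun j =>
                w k * 𝒞.maxFn 1 (i + 1) k (f j) y + 𝒞.maxFn w 0 i (f j) y := by
                refine seqNorm_mono hθ0 fun j => (maxFn_le_iff _ _ _ _).2 fun l hl => ?_
                have hl' := Finset.mem_Icc.1 hl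
                rcases Nat.lt_or_ge i l with hil | hil
                · refine le_add_right (mul_le_mul' (hw hl'.2) ?_)
                  simpa using le_maxFn (𝒞 := 𝒞) 1 (Nat.succ_le_of_lt hil) hl'.2 (f j) y
                · exact le_add_left (le_maxFn w hl'.1 hil (f j) y)
            _ ≤ w k * G (i + 1) y + V i y := by
                refine (seqNorm_add_le hθ.le _ _).trans (le_of_eq ?_)
                rw [seqNorm_const_mul hθ0]
            _ ≤ _ := by
                gcongr
                exact hyE.2.2
        calc V k y * h y ≤ (w k * a y + V i y) * h y := by gcongr
          _ = w k * a y * h y + (E i).indicator (fun y => V i y * h y) y := by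
              rw [Set.indicator_of_mem hyE, add_mul]
          _ ≤ _ := by
              gcongr
              exact Finset.single_le_sum (f := fun i => (E i).indicator (fun y => V i y * h y) y)
                (fun _ _ => zero_le) (Finset.mem_range.2 hik)
      · refine le_add_right (mul_le_mul' ?_ le_rfl)
        calc V k y ≤ seqNorm θ fun j => w k * 𝒞.maxFn 1 0 k (f j) y := by
              refine seqNorm_mono hθ0 fun j => (maxFn_le_iff _ _ _ _).2 fun l hl => ?_
              have hl' := Finset.mem_Icc.1 hl
              refine mul_le_mul' (hw hl'.2) ?_
              simpa using le_maxFn (𝒞 := 𝒞) 1 hl'.1 hl'.2 (f j) y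
          _ = w k * G 0 y := seqNorm_const_mul hθ0 _ _
          _ ≤ _ := mul_le_mul' le_rfl (not_lt.1 hyΩ)
    set Ψ : X → ℝ≥0∞ := fun y => 𝒞.maxFn w 0 k g y * 𝒞.maxFn 1 0 k h y with hΨ
    have hEm : ∀ i < k, MeasurableSet (E i) := fun i hi => (hEa i hi).measurableSet
    have hmain : ∫⁻ y in S, w k * a y * h y ∂μ ≤ 2 * A * ∫⁻ y in S ∩ Ωᶜ, Ψ y ∂μ := by
      set φ : X → ℝ≥0∞ := fun y => w k * 𝒞.avg k g y with hφ
      have hφeq : ∀ x y, 𝒞.idx k x = 𝒞.idx k y → φ x = φ y := fun x y hxy => by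
        simp only [hφ, avg_eq g hxy]
      have hφm : Measurable φ := (measurable_avg k g).const_mul _
      set ψ : X → ℝ≥0∞ := fun y => φ y * 𝒞.avg k h y with hψ
      have hψm : Measurable ψ := hφm.mul (measurable_avg k h)
      have hψeq : ∀ x y, 𝒞.idx k x = 𝒞.idx k y → ψ x = ψ y := fun x y hxy => by
        simp only [hψ, hφeq x y hxy, avg_eq h hxy]
      have e1 : ∫⁻ y in S, w k * a y * h y ∂μ = A * ∫⁻ y in S, ψ y ∂μ := by
        rw [hψ, setLIntegral_mul_avg hS hφeq hh, ← lintegral_const_mul _ (show Measurable fun y => φ y * h y from hφm.mul hh)]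
        refine lintegral_congr fun y => ?_
        simp only [ha, hφ]; ring
      have e2 : ∫⁻ y in S, ψ y ∂μ ≤ ∫⁻ y in S, 2 * Ωᶜ.indicator ψ y ∂μ := by
        refine setLIntegral_le_of_cell hS fun x _ => ?_
        have c1 : ∫⁻ y in 𝒞.cell k x, ψ y ∂μ = ψ x * 𝒞.mass k := by
          rw [← measure_cell k x, ← setLIntegral_const]
          exact setLIntegral_congr_fun (measurableSet_cell k x) fun y hy => hψeq y x hy
        have c2 : ∫⁻ y in 𝒞.cell k x, 2 * Ωᶜ.indicator ψ y ∂μ =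
            2 * (ψ x * μ (𝒞.cell k x ∩ Ωᶜ)) := by
          rw [lintegral_const_mul _ (hψm.indicator hΩm.compl), lintegral_indicator hΩm.compl,
            Measure.restrict_restrict hΩm.compl, Set.inter_comm, ← setLIntegral_const]
          congr 1
          exact setLIntegral_congr_fun ((measurableSet_cell k x).inter hΩm.compl)
            fun y hy => hψeq y x hy.1
        have hhalf : μ (𝒞.cell k x ∩ Ω) ≤ 𝒞.mass k / 2 := by
          refine le_trans (measure_mono ?_)
            (measure_cell_inter_seqNorm_maxFn_le hθ hf hD1 hDtop hD k x)
          rintro y ⟨hy, hyΩ⟩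
          refine ⟨hy, ?_⟩
          have h3 : a y < G 0 y := hyΩ
          rw [haeq y x hy] at h3
          exact h3
        have hmass : 𝒞.mass k ≤ 2 * μ (𝒞.cell k x ∩ Ωᶜ) := by
          have hadd : 𝒞.mass k = μ (𝒞.cell k x ∩ Ω) + μ (𝒞.cell k x ∩ Ωᶜ) := by
            rw [← measure_cell k x, ← Set.sdiff_eq]
            exact (measure_inter_add_sdiff _ hΩm).symm
          have h5 : 𝒞.mass k / 2 + 𝒞.mass k / 2 ≤ 𝒞.mass k / 2 + μ (𝒞.cell k x ∩ Ωᶜ) := by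
            rw [ENNReal.add_halves]
            exact hadd.le.trans (add_le_add hhalf le_rfl)
          have hfin : 𝒞.mass k / 2 ≠ ⊤ := ENNReal.div_ne_top (𝒞.mass_ne_top k) (by simp)
          have h6 := (ENNReal.add_le_add_iff_left hfin).1 h5
          rwa [ENNReal.div_le_iff_le_mul (by simp) (by simp), mul_comm] at h6
        rw [c1, c2, mul_left_comm]
        gcongr
      have e3 : ∫⁻ y in S, 2 * Ωᶜ.indicator ψ y ∂μ = 2 * ∫⁻ y in S ∩ Ωᶜ, ψ y ∂μ := by
        rw [lintegral_const_mul _ (hψm.indicator hΩm.compl), lintegral_indicator hΩm.compl,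
          Measure.restrict_restrict hΩm.compl, Set.inter_comm]
      rw [e1]
      calc A * ∫⁻ y in S, ψ y ∂μ ≤ A * (2 * ∫⁻ y in S ∩ Ωᶜ, ψ y ∂μ) := by
            rw [← e3]; exact mul_le_mul' le_rfl e2
        _ ≤ A * (2 * ∫⁻ y in S ∩ Ωᶜ, Ψ y ∂μ) := by
            refine mul_le_mul' le_rfl (mul_le_mul' le_rfl (lintegral_mono fun y => ?_))
            refine mul_le_mul' (le_maxFn w (Nat.zero_le k) le_rfl g y) ?_
            simpa using le_maxFn (𝒞 := 𝒞) 1 (Nat.zero_le k) le_rfl h y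
        _ = _ := by ring
    have hrest : ∀ i ∈ Finset.range k, ∫⁻ y in S, (E i).indicator (fun y => V i y * h y) y ∂μ ≤
        2 * A * ∫⁻ y in E i, Ψ y ∂μ := by
      intro i hi
      have hik := Finset.mem_range.1 hi
      rw [lintegral_indicator (hEm i hik), Measure.restrict_restrict (hEm i hik),
        Set.inter_eq_left.2 (Set.inter_subset_left : E i ⊆ S)]
      refine (ih i hik (hEa i hik)).trans (mul_le_mul' le_rfl (lintegral_mono fun y => ?_))
      exact mul_le_mul' (maxFn_mono_Icc w le_rfl hik.le g y) (maxFn_mono_Icc 1 le_rfl hik.le h y)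
    calc ∫⁻ y in S, V k y * h y ∂μ
        ≤ ∫⁻ y in S, (w k * a y * h y +
            ∑ i ∈ Finset.range k, (E i).indicator (fun y => V i y * h y) y) ∂μ :=
          setLIntegral_mono' hS.measurableSet hpt
      _ = ∫⁻ y in S, w k * a y * h y ∂μ + ∑ i ∈ Finset.range k,
            ∫⁻ y in S, (E i).indicator (fun y => V i y * h y) y ∂μ := by
          rw [lintegral_add_left, lintegral_finsetSum]
          · exact fun i hi => ((hVm i).mul hh).indicator (hEm i (Finset.mem_range.1 hi))
          · exact (((measurable_avg k g).const_mul A).const_mul (w k)).mul hh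
      _ ≤ 2 * A * ∫⁻ y in S ∩ Ωᶜ, Ψ y ∂μ + ∑ i ∈ Finset.range k, 2 * A * ∫⁻ y in E i, Ψ y ∂μ :=
          add_le_add hmain (Finset.sum_le_sum hrest)
      _ = 2 * A * ∫⁻ y in (S ∩ Ωᶜ) ∪ ⋃ i ∈ Finset.range k, E i, Ψ y ∂μ := by
          have hmU : MeasurableSet (⋃ i ∈ Finset.range k, E i) :=
            Finset.measurableSet_biUnion _ fun i hi => hEm i (Finset.mem_range.1 hi)
          rw [lintegral_union hmU, lintegral_biUnion_finset hEpd
            fun i hi => hEm i (Finset.mem_range.1 hi), mul_add, Finset.mul_sum]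
          refine Set.disjoint_left.2 fun y hy hy' => ?_
          simp only [Set.mem_iUnion] at hy'
          obtain ⟨i, _, hyi⟩ := hy'
          exact hy.2 (hEΩ i hyi)
      _ ≤ 2 * A * ∫⁻ y in S, Ψ y ∂μ := by
          refine mul_le_mul' le_rfl (lintegral_mono_set ?_)
          refine Set.union_subset Set.inter_subset_left (Set.iUnion₂_subset fun i _ => ?_)
          exact Set.inter_subset_left

end CellFiltration

/-! ### Dyadic grids in `ℝⁿ` -/

/-- The index of the half-open cube of side length `s` in the grid with origin `t` containing `x`. -/
def gridIdx {n : ℕ} (t : Rn n) (s : ℝ) (x : Rn n) : Fin n → ℤ := fun a => ⌊(x a - t a) / s⌋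

theorem measurable_gridIdx {n : ℕ} (t : Rn n) (s : ℝ) : Measurable (gridIdx t s) := by
  refine measurable_pi_lambda _ fun a => Int.measurable_floor.comp ?_
  fun_prop

theorem gridIdx_eq_iff {n : ℕ} (t : Rn n) {s : ℝ} (hs : 0 < s) (x : Rn n) (m : Fin n → ℤ) :
    gridIdx t s x = m ↔ ∀ a, t a + m a * s ≤ x a ∧ x a < t a + (m a + 1) * s := by
  rw [funext_iff]
  refine forall_congr' fun a => ?_
  rw [gridIdx, Int.floor_eq_iff, le_div_iff₀ hs, div_lt_iff₀ hs]
  constructor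
  · rintro ⟨h1, h2⟩; constructor <;> linarith
  · rintro ⟨h1, h2⟩; constructor <;> linarith

theorem volume_gridIdx_fiber {n : ℕ} (t : Rn n) {s : ℝ} (hs : 0 < s) (m : Fin n → ℤ) :
    volume {x : Rn n | gridIdx t s x = m} = ENNReal.ofReal s ^ n := by
  have e : {x : Rn n | gridIdx t s x = m} = WithLp.ofLp ⁻¹'
      (Set.univ.pi fun a => Set.Ico (t a + m a * s) (t a + (m a + 1) * s)) := by
    ext x
    simp only [Set.mem_preimage, Set.mem_univ_pi, Set.mem_Ico]
    exact gridIdx_eq_iff t hs x m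
  rw [e, (PiLp.volume_preserving_ofLp (Fin n)).measure_preimage
    (MeasurableSet.univ_pi fun _ => measurableSet_Ico).nullMeasurableSet, Real.volume_pi_Ico]
  have : ∀ a, t a + (m a + 1) * s - (t a + m a * s) = s := fun a => by ring
  simp [this]

theorem abs_sub_le_of_gridIdx_eq {n : ℕ} {t : Rn n} {s : ℝ} (hs : 0 < s) {x y : Rn n}
    (h : gridIdx t s x = gridIdx t s y) (a : Fin n) : |x a - y a| ≤ s := by
  have hx := (gridIdx_eq_iff t hs x _).1 h a
  have hy := (gridIdx_eq_iff t hs y _).1 rfl a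
  rw [abs_le]
  constructor <;> linarith [hx.1, hx.2, hy.1, hy.2]

theorem norm_sub_le_of_gridIdx_eq {n : ℕ} {t : Rn n} {s : ℝ} (hs : 0 < s) {x y : Rn n}
    (h : gridIdx t s x = gridIdx t s y) : ‖x - y‖ ≤ √n * s := by
  rw [EuclideanSpace.norm_eq]
  refine Real.sqrt_le_iff.2 ⟨by positivity, ?_⟩
  have : ∀ a ∈ Finset.univ, ‖(x - y) a‖ ^ 2 ≤ s ^ 2 := fun a _ => by
    have := abs_sub_le_of_gridIdx_eq hs h a
    rw [PiLp.sub_apply, Real.norm_eq_abs]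
    gcongr
  refine (Finset.sum_le_sum this).trans (le_of_eq ?_)
  rw [mul_pow, Real.sq_sqrt (Nat.cast_nonneg n)]
  simp

/-- The dyadic grid with origin `t` and cubes of side lengths `δ * 2 ^ i`. -/
def dyadicGrid {n : ℕ} (t : Rn n) {δ : ℝ} (hδ : 0 < δ) :
    CellFiltration (Rn n) (Fin n → ℤ) volume where
  idx i := gridIdx t (δ * 2 ^ i)
  measurable_idx i := measurable_gridIdx t _
  nested i x y h := by
    funext a
    have key : ∀ z : Rn n, (z a - t a) / (δ * 2 ^ (i + 1)) =
        (z a - t a) / (δ * 2 ^ i) / ((2 : ℕ) : ℝ) := by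
      intro z
      rw [pow_succ, div_div, mul_assoc]; norm_cast
    have ha := congrFun h a
    simp only [gridIdx] at ha ⊢
    rw [key, key, Int.floor_div_natCast, Int.floor_div_natCast, ha]
  mass i := ENNReal.ofReal (δ * 2 ^ i) ^ n
  mass_ne_zero i := by
    have : 0 < δ * 2 ^ i := by positivity
    simp [this]
  mass_ne_top i := ENNReal.pow_ne_top ENNReal.ofReal_ne_top
  measure_fiber i x := volume_gridIdx_fiber t (by positivity) _

theorem dyadicGrid_mass_succ_le {n : ℕ} (t : Rn n) {δ : ℝ} (hδ : 0 < δ) (i : ℕ) :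
    (dyadicGrid t hδ).mass (i + 1) ≤ 2 ^ n * (dyadicGrid t hδ).mass i := by
  change ENNReal.ofReal (δ * 2 ^ (i + 1)) ^ n ≤ 2 ^ n * ENNReal.ofReal (δ * 2 ^ i) ^ n
  rw [← mul_pow]
  refine le_of_eq (congrArg (· ^ n) ?_)
  rw [show (2 : ℝ≥0∞) = ENNReal.ofReal 2 by simp, ← ENNReal.ofReal_mul two_pos.le]
  congr 1; ring

theorem dyadicGrid_mass_rpow_mono {n : ℕ} (t : Rn n) {δ : ℝ} (hδ : 0 < δ) {β : ℝ} (hβ : 0 ≤ β) :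
    Monotone fun i => (dyadicGrid t hδ).mass i ^ β := fun _ _ hik =>
  ENNReal.rpow_le_rpow (CellFiltration.mass_mono hik) hβ

/-! ### Exponents -/

/-- `LogHolder` exponents with values in `[r, R]`, where `1 < r`. -/
structure LogHolderExponent {n : ℕ} (p : Rn n → ℝ) (r R : ℝ) : Prop where
  one_lt : 1 < r
  le : ∀ x, r ≤ p x
  ge : ∀ x, p x ≤ R
  locally : LogHolderLocal p
  infty : LogHolderInfty p

theorem LogHolderLocal.continuous {n : ℕ} {p : Rn n → ℝ} (hp : LogHolderLocal p) :
    Continuous p := by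
  obtain ⟨c, hc, h⟩ := hp
  refine continuous_iff_continuousAt.2 fun x => ?_
  have hlim : Filter.Tendsto (fun y : Rn n => c / (-Real.log ‖y - x‖)) (nhdsWithin x {x}ᶜ)
      (nhds 0) := by
    refine Filter.Tendsto.const_div_atTop ?_ c
    refine Filter.tendsto_neg_atBot_atTop.comp ?_
    refine Real.tendsto_log_nhdsGT_zero.comp ?_
    exact tendsto_norm_sub_self_nhdsNE x
  rw [continuousAt_iff_punctured_nhds, tendsto_iff_norm_sub_tendsto_zero]
  refine squeeze_zero' (Filter.Eventually.of_forall fun y => norm_nonneg _) ?_ hlim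
  have hball : ∀ᶠ y in nhdsWithin x {x}ᶜ, y ∈ Metric.ball x (1 / 2) :=
    mem_nhdsWithin_of_mem_nhds (Metric.ball_mem_nhds x (by norm_num))
  filter_upwards [hball] with y hy
  rw [Real.norm_eq_abs]
  exact h y x (by rwa [Metric.mem_ball, dist_eq_norm] at hy)

theorem logHolderInfty_limit_mem {n : ℕ} (hn : 0 < n) {p : Rn n → ℝ} {r R C pinf : ℝ}
    (hr : ∀ x, r ≤ p x) (hR : ∀ x, p x ≤ R)
    (h : ∀ x : Rn n, |p x - pinf| ≤ C / Real.log (Real.exp 1 + ‖x‖)) : r ≤ pinf ∧ pinf ≤ R := by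
  have hlim : Filter.Tendsto (fun m : ℕ => C / Real.log (Real.exp 1 + m)) Filter.atTop
      (nhds 0) := by
    refine Filter.Tendsto.const_div_atTop ?_ C
    refine Real.tendsto_log_atTop.comp ?_
    exact Filter.tendsto_atTop_add_const_left _ _ tendsto_natCast_atTop_atTop
  have hx : ∀ m : ℕ, ∃ x : Rn n, ‖x‖ = m := fun m =>
    ⟨EuclideanSpace.single ⟨0, hn⟩ (m : ℝ), by simp⟩
  constructor
  · refine le_of_tendsto_of_tendsto' (f := fun m : ℕ => r) (g := fun m : ℕ =>
      pinf + C / Real.log (Real.exp 1 + m)) tendsto_const_nhds (by simpa using hlim.const_add pinf)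
      fun m => ?_
    obtain ⟨x, hx⟩ := hx m
    have := h x
    rw [hx] at this
    linarith [hr x, (abs_le.1 this).2]
  · refine le_of_tendsto_of_tendsto' (g := fun m : ℕ => R) (f := fun m : ℕ =>
      pinf - C / Real.log (Real.exp 1 + m)) (by simpa using hlim.const_sub pinf) tendsto_const_nhds
      fun m => ?_
    obtain ⟨x, hx⟩ := hx m
    have := h x
    rw [hx] at this
    linarith [hR x, (abs_le.1 this).1]

/-- In a small cube, a log-Hölder continuous exponent oscillates little. -/
theorem abs_sub_le_of_gridIdx_eq_of_logHolder {n : ℕ} (hn : 0 < n) {p : Rn n → ℝ} {c : ℝ}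
    (hc : 0 < c)
    (hp : ∀ x y : Rn n, ‖x - y‖ < 1 / 2 → |p x - p y| ≤ c / (-Real.log ‖x - y‖))
    {t : Rn n} {s : ℝ} (hs : 0 < s) (hs1 : s ≤ 1 / (8 * n)) {x y : Rn n}
    (h : gridIdx t s x = gridIdx t s y) : |p x - p y| ≤ 2 * c / (-Real.log s) := by
  have hn1 : (1 : ℝ) ≤ n := by exact_mod_cast hn
  have hs8 : s ≤ 1 / 8 := hs1.trans (by gcongr; linarith)
  have hlogs : Real.log s < 0 := Real.log_neg hs (by linarith)
  rcases eq_or_ne x y with rfl | hxy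
  · simp only [sub_self, abs_zero]
    exact div_nonneg (by linarith) (by linarith)
  have hns : n * s ≤ 1 := by
    have := mul_le_mul_of_nonneg_left hs1 (by linarith : (0 : ℝ) ≤ n)
    have e : (n : ℝ) * (1 / (8 * n)) = 1 / 8 := by field_simp
    linarith
  have hd : ‖x - y‖ ≤ √s := by
    refine (norm_sub_le_of_gridIdx_eq hs h).trans ?_
    calc √n * s = √n * (√s * √s) := by rw [Real.mul_self_sqrt hs.le]
      _ = √(n * s) * √s := by rw [Real.sqrt_mul (by linarith)]; ring
      _ ≤ 1 * √s := by
        gcongr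
        exact Real.sqrt_le_iff.2 ⟨zero_le_one, by simpa using hns⟩
      _ = √s := one_mul _
  have hs2 : √s < 1 / 2 := by
    rw [Real.sqrt_lt' (by norm_num)]; norm_num; linarith
  have hpos : 0 < ‖x - y‖ := norm_pos_iff.2 (sub_ne_zero.2 hxy)
  refine (hp x y (hd.trans_lt hs2)).trans ?_
  have hlog : Real.log ‖x - y‖ ≤ Real.log s / 2 := by
    rw [← Real.log_sqrt hs.le]
    exact Real.log_le_log hpos hd
  rw [div_le_div_iff₀ (by linarith) (by linarith)]
  nlinarith

/-! ### Modular estimates for the scalar dyadic fractional maximal function -/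

theorem mass_rpow_mul_rpow_eq {m a : ℝ≥0∞} {p q β : ℝ}
    (hp : 0 < p) (hq : 0 < q) (hβ : 0 ≤ β) (h : 1 / q = 1 / p - β) :
    (m ^ β * a) ^ q = a ^ p * (m * a ^ p) ^ (β * q) := by
  have hβq : 0 ≤ β * q := mul_nonneg hβ hq.le
  have e : q = p + p * (β * q) := by
    have h1 : 1 / p = 1 / q + β := by linarith
    have h2 : q = p * (q * (1 / q + β)) := by rw [← h1]; field_simp
    rw [mul_add, mul_one_div_cancel hq.ne'] at h2
    linarith
  rw [ENNReal.mul_rpow_of_nonneg _ _ hq.le, ← ENNReal.rpow_mul,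
    ENNReal.mul_rpow_of_nonneg _ _ hβq, ← ENNReal.rpow_mul]
  conv_lhs => rw [show a ^ q = a ^ (p + p * (β * q)) by rw [← e]]
  rw [ENNReal.rpow_add_of_nonneg _ _ hp.le (mul_nonneg hp.le hβq)]
  ring

theorem maxFn_rpow_le {X ι : Type*} [MeasurableSpace X] [MeasurableSpace ι] {μ : Measure X}
    {𝒞 : CellFiltration X ι μ} {w : ℕ → ℝ≥0∞} {i k : ℕ} {F : X → ℝ≥0∞} {x : X} {q : ℝ}
    (hq : 0 < q) {b : ℝ≥0∞}
    (h : ∀ l ∈ Finset.Icc i k, (w l * 𝒞.avg l F x) ^ q ≤ b) : 𝒞.maxFn w i k F x ^ q ≤ b := by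
  have h1 : 𝒞.maxFn w i k F x ≤ b ^ (1 / q) := by
    rw [CellFiltration.maxFn_le_iff]
    intro l hl
    have := ENNReal.rpow_le_rpow (h l hl) (one_div_nonneg.2 hq.le)
    rwa [← ENNReal.rpow_mul, mul_one_div_cancel hq.ne', ENNReal.rpow_one] at this
  have := ENNReal.rpow_le_rpow h1 hq.le
  rwa [← ENNReal.rpow_mul, one_div_mul_cancel hq.ne', ENNReal.rpow_one] at this

/-- The decay function used to compare exponents at infinity. -/
def decay {n : ℕ} (x : Rn n) : ℝ≥0∞ := ENNReal.ofReal ((1 + ‖x‖) ^ (-(n + 1 : ℝ)))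

theorem measurable_decay {n : ℕ} : Measurable (decay (n := n)) := by
  unfold decay; fun_prop

theorem lintegral_decay_ne_top {n : ℕ} : ∫⁻ x : Rn n, decay x ≠ ⊤ := by
  refine (finite_integral_one_add_norm (E := Rn n) (r := n + 1) ?_).ne
  simp

theorem rpow_le_add_decay {n : ℕ} {v : ℝ≥0∞} (hv : v ≤ 1) {x : Rn n} {a b C : ℝ} (ha : 1 ≤ a)
    (hC : 0 ≤ C) (hab : |a - b| ≤ C / Real.log (Real.exp 1 + ‖x‖)) :
    v ^ a ≤ ENNReal.ofReal (Real.exp ((n + 1) * C)) * v ^ b + decay x := by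
  have hK : (1 : ℝ≥0∞) ≤ ENNReal.ofReal (Real.exp ((n + 1) * C)) :=
    ENNReal.one_le_ofReal.2 (Real.one_le_exp (by positivity))
  rcases le_total v (decay x) with hvd | hvd
  · refine le_add_left (le_trans ?_ hvd)
    calc v ^ a ≤ v ^ (1 : ℝ) := ENNReal.rpow_le_rpow_of_exponent_ge hv ha
      _ = v := ENNReal.rpow_one v
  · refine le_add_right ?_
    rcases le_total b a with hba | hba
    · exact (ENNReal.rpow_le_rpow_of_exponent_ge hv hba).trans (le_mul_of_one_le_left zero_le hK)
    have hx1 : 0 < 1 + ‖x‖ := by positivity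
    have hd0 : 0 < decay x := by
      unfold decay; rw [ENNReal.ofReal_pos]; positivity
    have hv0 : v ≠ 0 := (hd0.trans_le hvd).ne'
    have hvt : v ≠ ⊤ := (hv.trans_lt ENNReal.one_lt_top).ne
    have e : v ^ a = v ^ (-(b - a)) * v ^ b := by
      rw [← ENNReal.rpow_add _ _ hv0 hvt]; congr 1; ring
    rw [e]
    gcongr
    calc v ^ (-(b - a)) ≤ decay x ^ (-(b - a)) := by
          rw [ENNReal.rpow_neg, ENNReal.rpow_neg]
          exact ENNReal.inv_le_inv.2 (ENNReal.rpow_le_rpow hvd (by linarith))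
      _ = ENNReal.ofReal ((1 + ‖x‖) ^ ((n + 1 : ℝ) * (b - a))) := by
          unfold decay
          rw [ENNReal.ofReal_rpow_of_pos (by positivity), ← Real.rpow_mul hx1.le]
          congr 2; ring
      _ ≤ _ := by
          refine ENNReal.ofReal_le_ofReal ?_
          rw [Real.rpow_def_of_pos hx1]
          refine Real.exp_le_exp.2 ?_
          have hexp : (1 : ℝ) ≤ Real.exp 1 := Real.one_le_exp zero_le_one
          have hlog0 : 0 ≤ Real.log (1 + ‖x‖) := Real.log_nonneg (by linarith [norm_nonneg x])
          have hlog1 : Real.log (1 + ‖x‖) ≤ Real.log (Real.exp 1 + ‖x‖) :=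
            Real.log_le_log hx1 (by linarith)
          have hlogpos : 0 < Real.log (Real.exp 1 + ‖x‖) := by
            refine Real.log_pos ?_
            linarith [Real.add_one_lt_exp (one_ne_zero), norm_nonneg x]
          have h1 : b - a ≤ C / Real.log (Real.exp 1 + ‖x‖) := by
            linarith [(abs_le.1 hab).1]
          have h2 : Real.log (1 + ‖x‖) * (b - a) ≤ C := by
            calc Real.log (1 + ‖x‖) * (b - a) ≤ Real.log (Real.exp 1 + ‖x‖) * (b - a) := by
                  gcongr
              _ ≤ Real.log (Real.exp 1 + ‖x‖) * (C / Real.log (Real.exp 1 + ‖x‖)) := by gcongr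
              _ = C := by field_simp
          calc Real.log (1 + ‖x‖) * ((n + 1 : ℝ) * (b - a))
              = (n + 1 : ℝ) * (Real.log (1 + ‖x‖) * (b - a)) := by ring
            _ ≤ _ := by gcongr

/-- The averages of functions which do not take values in `(0, 1)`. -/
theorem exists_avg_rpow_le_of_one_le {n : ℕ} (hn : 0 < n) {p : Rn n → ℝ} {r R : ℝ}
    (hp : LogHolderExponent p r R) :
    ∃ C : ℝ≥0∞, 1 ≤ C ∧ C ≠ ⊤ ∧ ∀ (t : Rn n) (δ : ℝ) (hδ : 0 < δ) (g : Rn n → ℝ≥0∞),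
      Measurable g → (∀ y, g y = 0 ∨ 1 ≤ g y) → ∫⁻ y, g y ^ p y ≤ 1 → ∀ (i : ℕ) (x : Rn n),
        (dyadicGrid t hδ).avg i g x ^ p x ≤
          C * (dyadicGrid t hδ).avg i (fun y => g y ^ (p y / r)) x ^ r := by
  obtain ⟨c, hc, hcp⟩ := hp.locally
  have hr0 : 0 < r := by linarith [hp.one_lt]
  have hpm : Measurable p := hp.locally.continuous.measurable
  have hn' : (0 : ℝ) < n := by exact_mod_cast hn
  set m₀ : ℝ≥0∞ := ENNReal.ofReal (1 / (8 * n)) ^ n with hm₀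
  have hm₀0 : m₀ ≠ 0 := by
    have h0 : ENNReal.ofReal (1 / (8 * (n : ℝ))) ≠ 0 := by
      rw [Ne, ENNReal.ofReal_eq_zero, not_le]; positivity
    exact pow_ne_zero _ h0
  have hm₀1 : m₀ ≤ 1 := by
    refine pow_le_one' ?_ n
    rw [ENNReal.ofReal_le_one, div_le_one (by positivity)]
    have : (1 : ℝ) ≤ n := by exact_mod_cast hn
    linarith
  have hB1 : 1 ≤ m₀⁻¹ := ENNReal.one_le_inv.2 hm₀1
  have hR0 : 0 ≤ R := hr0.le.trans ((hp.le 0).trans (hp.ge 0))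
  set K : ℝ≥0∞ := ENNReal.ofReal (Real.exp (2 * c * n)) with hK
  have hK1 : 1 ≤ K := ENNReal.one_le_ofReal.2 (Real.one_le_exp (by positivity))
  refine ⟨K + m₀⁻¹ ^ R, le_add_right hK1, ?_, ?_⟩
  · exact ENNReal.add_ne_top.2 ⟨ENNReal.ofReal_ne_top,
      ENNReal.rpow_ne_top_of_nonneg hR0 (ENNReal.inv_ne_top.2 hm₀0)⟩
  intro t δ hδ g hg hg1 hint i x
  set 𝒟 := dyadicGrid t hδ with h𝒟
  set s : ℝ := δ * 2 ^ i with hs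
  have hs0 : 0 < s := by positivity
  have hmass : 𝒟.mass i = ENNReal.ofReal s ^ n := rfl
  have hidx : ∀ y ∈ 𝒟.cell i x, gridIdx t s y = gridIdx t s x := fun y hy => hy
  set a := 𝒟.avg i g x with ha
  set b := 𝒟.avg i (fun y => g y ^ (p y / r)) x with hb
  have hmono : ∀ (y : Rn n) (u v : ℝ), 0 < u → u ≤ v → g y ^ u ≤ g y ^ v := by
    intro y u v hu huv
    rcases hg1 y with h0 | h1
    · rw [h0, ENNReal.zero_rpow_of_pos hu, ENNReal.zero_rpow_of_pos (hu.trans_le huv)]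
    · exact ENNReal.rpow_le_rpow_of_exponent_le h1 huv
  have hpr : ∀ y, 1 ≤ p y / r := fun y => (one_le_div hr0).2 (hp.le y)
  have hbm : b ≤ (𝒟.mass i)⁻¹ := by
    rw [hb, CellFiltration.avg, div_eq_mul_inv]
    refine (mul_le_mul' ?_ le_rfl).trans (one_mul _).le
    refine le_trans ?_ hint
    refine (setLIntegral_le_lintegral _ _).trans (lintegral_mono fun y => ?_)
    refine hmono y _ _ (by linarith [hpr y]) ?_
    exact div_le_self (by linarith [hp.le y]) hp.one_lt.le
  rw [add_mul]
  by_cases hsmall : s ≤ 1 / (8 * n)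
  · refine le_add_right ?_
    set ε : ℝ := 2 * c / (-Real.log s) with hε
    have hn1 : (1 : ℝ) ≤ n := by exact_mod_cast hn
    have hs8 : s ≤ 1 / 8 := hsmall.trans (by gcongr; linarith)
    have hlogs : Real.log s < 0 := Real.log_neg hs0 (by linarith)
    have hε0 : 0 ≤ ε := div_nonneg (by linarith) (by linarith)
    set π : ℝ := max r (p x - ε) with hπ
    have hπr : r ≤ π := le_max_left _ _
    have hπ0 : 0 < π := hr0.trans_le hπr
    have hπp : ∀ y ∈ 𝒟.cell i x, π ≤ p y := by
      intro y hy
      refine max_le (hp.le y) ?_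
      have := abs_sub_le_of_gridIdx_eq_of_logHolder hn hc hcp hs0 hsmall (hidx y hy)
      linarith [(abs_le.1 this).1]
    have hπx : π ≤ p x := hπp x (CellFiltration.mem_cell_self i x)
    have h1 : a ^ (π / r) ≤ b := by
      refine (CellFiltration.avg_rpow_le i hg ((one_le_div hr0).2 hπr) x).trans ?_
      refine CellFiltration.avg_mono (fun y hy => ?_) (CellFiltration.measurableSet_cell i x)
      refine hmono y _ _ (by positivity) ?_
      gcongr
      exact hπp y hy
    have h2 : a ^ p x ≤ b ^ (r * p x / π) := by
      have := ENNReal.rpow_le_rpow h1 (z := r * p x / π)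
        (div_nonneg (mul_nonneg hr0.le (hπ0.le.trans hπx)) hπ0.le)
      rw [← ENNReal.rpow_mul] at this
      have e : π / r * (r * p x / π) = p x := by field_simp
      rwa [e] at this
    refine h2.trans ?_
    have hrp : r ≤ r * p x / π := by
      rw [le_div_iff₀ hπ0]; gcongr
    rcases le_total b 1 with hb1 | hb1
    · exact (ENNReal.rpow_le_rpow_of_exponent_ge hb1 hrp).trans
        (le_mul_of_one_le_left zero_le hK1)
    · have hexp : r * p x / π ≤ ε + r := by
        have h3 : p x - π ≤ ε := by linarith [le_max_right r (p x - ε)]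
        rw [div_le_iff₀ hπ0]
        nlinarith
      calc b ^ (r * p x / π) ≤ b ^ (ε + r) := ENNReal.rpow_le_rpow_of_exponent_le hb1 hexp
        _ = b ^ ε * b ^ r := ENNReal.rpow_add_of_nonneg _ _ hε0 hr0.le
        _ ≤ K * b ^ r := by
          gcongr
          calc b ^ ε ≤ (𝒟.mass i)⁻¹ ^ ε := ENNReal.rpow_le_rpow hbm hε0
            _ = ENNReal.ofReal (((s ^ n)⁻¹) ^ ε) := by
              rw [hmass, ← ENNReal.ofReal_pow hs0.le, ← ENNReal.ofReal_inv_of_pos (by positivity),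
                ENNReal.ofReal_rpow_of_pos (by positivity)]
            _ ≤ K := by
              refine ENNReal.ofReal_le_ofReal (le_of_eq ?_)
              rw [Real.rpow_def_of_pos (by positivity), Real.log_inv, Real.log_pow, hε]
              congr 1
              have : Real.log s ≠ 0 := hlogs.ne
              field_simp
  · refine le_add_left ?_
    have hbB : b ≤ m₀⁻¹ := by
      refine hbm.trans (ENNReal.inv_le_inv.2 ?_)
      rw [hmass, hm₀]
      exact pow_le_pow_left' (ENNReal.ofReal_le_ofReal (not_le.1 hsmall).le) n
    have hab : a ≤ b := by
      refine CellFiltration.avg_mono (fun y _ => ?_) (CellFiltration.measurableSet_cell i x)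
      simpa using hmono y 1 (p y / r) one_pos (hpr y)
    calc a ^ p x ≤ b ^ p x := ENNReal.rpow_le_rpow hab (hr0.le.trans (hp.le x))
      _ = b ^ (p x - r) * b ^ r := by
          rw [← ENNReal.rpow_add_of_nonneg _ _ (by linarith [hp.le x]) hr0.le, sub_add_cancel]
      _ ≤ m₀⁻¹ ^ (p x - r) * b ^ r := by
          gcongr
          linarith [hp.le x]
      _ ≤ m₀⁻¹ ^ R * b ^ r := by
          gcongr
          linarith [hp.ge x]

/-- The modular estimate for functions which do not take values in `(0, 1)`. -/
theorem exists_lintegral_maxFn_rpow_le_of_one_le {n : ℕ} (hn : 0 < n) {p q : Rn n → ℝ}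
    {r R Q β : ℝ} (hp : LogHolderExponent p r R) (hβ : 0 ≤ β) (hq0 : ∀ x, 0 < q x)
    (hqQ : ∀ x, q x ≤ Q) (hq : ∀ x, 1 / q x = 1 / p x - β) :
    ∃ C : ℝ≥0∞, C ≠ ⊤ ∧ ∀ (t : Rn n) (δ : ℝ) (hδ : 0 < δ) (k : ℕ) (g : Rn n → ℝ≥0∞),
      Measurable g → (∀ y, g y = 0 ∨ 1 ≤ g y) → ∫⁻ y, g y ^ p y ≤ 1 →
        ∫⁻ x, (dyadicGrid t hδ).maxFn (fun i => (dyadicGrid t hδ).mass i ^ β) 0 k g x ^ q x ≤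
          C := by
  obtain ⟨C₁, hC1, hCt, hC⟩ := exists_avg_rpow_le_of_one_le hn hp
  have hr1 := hp.one_lt
  have hr0 : 0 < r := by linarith
  have hpm : Measurable p := hp.locally.continuous.measurable
  have hQ0 : 0 ≤ Q := (hq0 0).le.trans (hqQ 0)
  have hC₁β : C₁ ^ (β * Q) ≠ ⊤ := ENNReal.rpow_ne_top_of_nonneg (mul_nonneg hβ hQ0) hCt
  refine ⟨C₁ * C₁ ^ (β * Q) * ENNReal.ofReal (2 ^ r * r / (r - 1)),
    ENNReal.mul_ne_top (ENNReal.mul_ne_top hCt hC₁β) ENNReal.ofReal_ne_top, ?_⟩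
  intro t δ hδ k g hg hg1 hint
  set 𝒟 := dyadicGrid t hδ
  set F : Rn n → ℝ≥0∞ := fun y => g y ^ (p y / r) with hF
  have hFm : Measurable F := hg.pow (hpm.div_const r)
  have hFr : ∀ y, F y ^ r = g y ^ p y := fun y => by
    rw [hF, ← ENNReal.rpow_mul, div_mul_cancel₀ _ hr0.ne']
  have hpt : ∀ x, 𝒟.maxFn (fun i => 𝒟.mass i ^ β) 0 k g x ^ q x ≤
      C₁ * C₁ ^ (β * Q) * 𝒟.maxFn 1 0 k F x ^ r := by
    intro x
    refine maxFn_rpow_le (hq0 x) fun l hl => ?_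
    have hl' := Finset.mem_Icc.1 hl
    have hpx : 0 < p x := hr0.trans_le (hp.le x)
    rw [mass_rpow_mul_rpow_eq hpx (hq0 x) hβ (hq x)]
    have h1 := hC t δ hδ g hg hg1 hint l x
    have h2 : 𝒟.mass l * 𝒟.avg l g x ^ p x ≤ C₁ := by
      calc 𝒟.mass l * 𝒟.avg l g x ^ p x ≤ 𝒟.mass l * (C₁ * 𝒟.avg l F x ^ r) := by gcongr
        _ ≤ 𝒟.mass l * (C₁ * 𝒟.avg l (fun y => F y ^ r) x) := by
            gcongr
            exact CellFiltration.avg_rpow_le l hFm hr1.le x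
        _ = C₁ * ∫⁻ y in 𝒟.cell l x, g y ^ p y := by
            simp_rw [hFr]
            rw [CellFiltration.avg, mul_left_comm,
              ENNReal.mul_div_cancel (𝒟.mass_ne_zero l) (𝒟.mass_ne_top l)]
        _ ≤ C₁ * 1 := by
            gcongr
            exact (setLIntegral_le_lintegral _ _).trans hint
        _ = C₁ := mul_one _
    have h3 : 𝒟.avg l F x ≤ 𝒟.maxFn 1 0 k F x := by
      simpa using CellFiltration.le_maxFn (𝒞 := 𝒟) 1 hl'.1 hl'.2 F x
    calc 𝒟.avg l g x ^ p x * (𝒟.mass l * 𝒟.avg l g x ^ p x) ^ (β * q x)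
        ≤ (C₁ * 𝒟.maxFn 1 0 k F x ^ r) * C₁ ^ (β * Q) := by
          refine mul_le_mul' (h1.trans ?_) ?_
          · gcongr
          · refine (ENNReal.rpow_le_rpow h2 (mul_nonneg hβ (hq0 x).le)).trans ?_
            exact ENNReal.rpow_le_rpow_of_exponent_le hC1 (by gcongr; exact hqQ x)
      _ = _ := by ring
  have hdoob := CellFiltration.setLIntegral_maxFn_rpow_le (𝒞 := 𝒟) hFm hr1 k
    (D := Set.univ) (fun _ _ _ _ => trivial)
  simp only [Measure.restrict_univ] at hdoob
  calc ∫⁻ x, 𝒟.maxFn (fun i => 𝒟.mass i ^ β) 0 k g x ^ q x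
      ≤ ∫⁻ x, C₁ * C₁ ^ (β * Q) * 𝒟.maxFn 1 0 k F x ^ r := lintegral_mono hpt
    _ = C₁ * C₁ ^ (β * Q) * ∫⁻ x, 𝒟.maxFn 1 0 k F x ^ r :=
        lintegral_const_mul _ ((CellFiltration.measurable_maxFn _ _ _ _).pow_const r)
    _ ≤ C₁ * C₁ ^ (β * Q) * (ENNReal.ofReal (2 ^ r * r / (r - 1)) * ∫⁻ x, F x ^ r) := by
        gcongr
    _ ≤ C₁ * C₁ ^ (β * Q) * (ENNReal.ofReal (2 ^ r * r / (r - 1)) * 1) := by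
        gcongr
        simpa only [hFr] using hint
    _ = _ := by rw [mul_one]

/-- The modular estimate for functions with values in `[0, 1]`. -/
theorem exists_lintegral_maxFn_rpow_le_of_le_one {n : ℕ} (hn : 0 < n) {p q : Rn n → ℝ}
    {r R Q β : ℝ} (hp : LogHolderExponent p r R) (hβ : 0 ≤ β) (hβR : β < 1 / R)
    (hq0 : ∀ x, 0 < q x) (hqQ : ∀ x, q x ≤ Q) (hq : ∀ x, 1 / q x = 1 / p x - β) :
    ∃ C : ℝ≥0∞, C ≠ ⊤ ∧ ∀ (t : Rn n) (δ : ℝ) (hδ : 0 < δ) (k : ℕ) (g : Rn n → ℝ≥0∞),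
      Measurable g → (∀ y, g y ≤ 1) → ∫⁻ y, g y ^ p y ≤ 1 →
        ∫⁻ x, (dyadicGrid t hδ).maxFn (fun i => (dyadicGrid t hδ).mass i ^ β) 0 k g x ^ q x ≤
          C := by
  obtain ⟨C, hC, pinf, hpinf⟩ := hp.infty
  have hr1 := hp.one_lt
  have hr0 : 0 < r := by linarith
  obtain ⟨hrp, hpR⟩ := logHolderInfty_limit_mem hn hp.le hp.ge hpinf
  have hpm : Measurable p := hp.locally.continuous.measurable
  have hpinf0 : 0 < pinf := hr0.trans_le hrp
  have hQ0 : 0 ≤ Q := (hq0 0).le.trans (hqQ 0)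
  have hR0 : 0 < R := hpinf0.trans_le hpR
  -- the limit exponents
  have hinv : 0 < 1 / pinf - β := by
    have : 1 / R ≤ 1 / pinf := one_div_le_one_div_of_le hpinf0 hpR
    linarith
  set qinf : ℝ := 1 / (1 / pinf - β) with hqinf
  have hqinf0 : 0 < qinf := one_div_pos.2 hinv
  have hqinf' : 1 / qinf = 1 / pinf - β := by rw [hqinf, one_div_one_div]
  have one_le_q : ∀ u v : ℝ, 0 < u → 1 ≤ v → 1 / u = 1 / v - β → 1 ≤ u := by
    intro u v hu hv h
    have h1 : 1 / v ≤ 1 := by rw [div_le_one (by linarith)]; exact hv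
    have h2 : 1 / u ≤ 1 := by linarith
    rwa [div_le_one hu] at h2
  have hq1 : ∀ x, 1 ≤ q x := fun x => one_le_q _ _ (hq0 x) (by linarith [hp.le x]) (hq x)
  have hqinf1 : 1 ≤ qinf := one_le_q _ _ hqinf0 (by linarith) hqinf'
  set Q' := max Q qinf with hQ'
  have hqdiff : ∀ x, |q x - qinf| ≤ Q' * Q' * C / Real.log (Real.exp 1 + ‖x‖) := by
    intro x
    have hpx : 1 ≤ p x := by linarith [hp.le x]
    have hpx0 : 0 < p x := by linarith
    have e : q x - qinf = q x * qinf * ((p x - pinf) / (p x * pinf)) := by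
      have h1 : (p x - pinf) / (p x * pinf) = 1 / qinf - 1 / q x := by
        rw [hqinf', hq x]; field_simp; ring
      rw [h1]
      have := hq0 x
      field_simp
    rw [e, abs_mul, abs_div, abs_of_pos (mul_pos (hq0 x) hqinf0), abs_of_pos (mul_pos hpx0 hpinf0)]
    have h2 : |p x - pinf| / (p x * pinf) ≤ |p x - pinf| := by
      refine div_le_self (abs_nonneg _) ?_
      nlinarith
    calc q x * qinf * (|p x - pinf| / (p x * pinf))
        ≤ Q' * Q' * (C / Real.log (Real.exp 1 + ‖x‖)) := by
          refine mul_le_mul ?_ (h2.trans (hpinf x)) (by positivity) (by positivity)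
          exact mul_le_mul ((hqQ x).trans (le_max_left _ _)) (le_max_right _ _) hqinf0.le
            (by positivity)
      _ = _ := by rw [mul_div_assoc]
  set I : ℝ≥0∞ := ∫⁻ x : Rn n, decay x with hI
  have hIt : I ≠ ⊤ := lintegral_decay_ne_top
  set K₁ : ℝ≥0∞ := ENNReal.ofReal (Real.exp ((n + 1) * C)) with hK₁
  set K₂ : ℝ≥0∞ := ENNReal.ofReal (Real.exp ((n + 1) * (Q' * Q' * C))) with hK₂
  set C₂ : ℝ≥0∞ := K₁ + I with hC₂
  have hC₂1 : 1 ≤ C₂ :=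
    le_add_right (ENNReal.one_le_ofReal.2 (Real.one_le_exp (by positivity)))
  have hC₂t : C₂ ≠ ⊤ := ENNReal.add_ne_top.2 ⟨ENNReal.ofReal_ne_top, hIt⟩
  set C₃ : ℝ≥0∞ := C₂ ^ (β * qinf) with hC₃
  have hC₃1 : 1 ≤ C₃ := by
    rw [hC₃, ← ENNReal.rpow_zero (x := C₂)]
    exact ENNReal.rpow_le_rpow_of_exponent_le hC₂1 (mul_nonneg hβ hqinf0.le)
  have hC₃t : C₃ ≠ ⊤ := ENNReal.rpow_ne_top_of_nonneg (mul_nonneg hβ hqinf0.le) hC₂t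
  have hC₃0 : C₃ ≠ 0 := (zero_lt_one.trans_le hC₃1).ne'
  have hC₃Q : C₃ ^ Q ≠ ⊤ := ENNReal.rpow_ne_top_of_nonneg hQ0 hC₃t
  have hpinf1 : 1 < pinf := hr1.trans_le hrp
  refine ⟨C₃ ^ Q * (K₂ * C₃ * (ENNReal.ofReal (2 ^ pinf * pinf / (pinf - 1)) * C₂) + I), ?_, ?_⟩
  · refine ENNReal.mul_ne_top hC₃Q (ENNReal.add_ne_top.2 ⟨?_, hIt⟩)
    exact ENNReal.mul_ne_top (ENNReal.mul_ne_top ENNReal.ofReal_ne_top hC₃t)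
      (ENNReal.mul_ne_top ENNReal.ofReal_ne_top hC₂t)
  intro t δ hδ k g hg hg1 hint
  set 𝒟 := dyadicGrid t hδ
  have hgp : ∫⁻ y, g y ^ pinf ≤ C₂ := by
    calc ∫⁻ y, g y ^ pinf ≤ ∫⁻ y, (K₁ * g y ^ p y + decay y) :=
          lintegral_mono fun y => rpow_le_add_decay (hg1 y) hpinf1.le
            hC.le (by rw [abs_sub_comm]; exact hpinf y)
      _ = K₁ * (∫⁻ y, g y ^ p y) + I := by
          rw [lintegral_add_right _ measurable_decay, lintegral_const_mul _ (hg.pow hpm)]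
      _ ≤ K₁ * 1 + I := by gcongr
      _ = C₂ := by rw [mul_one]
  have hpt : ∀ x, 𝒟.maxFn (fun i => 𝒟.mass i ^ β) 0 k g x ^ q x ≤
      C₃ ^ Q * (K₂ * C₃ * 𝒟.maxFn 1 0 k g x ^ pinf + decay x) := by
    intro x
    refine maxFn_rpow_le (hq0 x) fun l hl => ?_
    have hl' := Finset.mem_Icc.1 hl
    set a := 𝒟.avg l g x with ha
    set v := 𝒟.mass l ^ β * a with hv
    have ha1 : a ≤ 1 := by
      refine (CellFiltration.avg_mono (fun y _ => hg1 y)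
        (CellFiltration.measurableSet_cell l x)).trans ?_
      rw [CellFiltration.avg_const]
    have hvq : v ^ qinf ≤ C₃ * a ^ pinf := by
      rw [hv, mass_rpow_mul_rpow_eq hpinf0 hqinf0 hβ hqinf',
        mul_comm]
      refine mul_le_mul' (ENNReal.rpow_le_rpow ?_ (mul_nonneg hβ hqinf0.le)) le_rfl
      calc 𝒟.mass l * a ^ pinf ≤ 𝒟.mass l * 𝒟.avg l (fun y => g y ^ pinf) x := by
            gcongr
            exact CellFiltration.avg_rpow_le l hg hpinf1.le x
        _ = ∫⁻ y in 𝒟.cell l x, g y ^ pinf := by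
            rw [CellFiltration.avg, ENNReal.mul_div_cancel (𝒟.mass_ne_zero l) (𝒟.mass_ne_top l)]
        _ ≤ C₂ := (setLIntegral_le_lintegral _ _).trans hgp
    have hvC : v ≤ C₃ := by
      have h1 : v ^ qinf ≤ C₃ ^ qinf := by
        calc v ^ qinf ≤ C₃ * a ^ pinf := hvq
          _ ≤ C₃ * 1 := by gcongr; exact ENNReal.rpow_le_one ha1 hpinf0.le
          _ = C₃ ^ (1 : ℝ) := by rw [mul_one, ENNReal.rpow_one]
          _ ≤ C₃ ^ qinf := ENNReal.rpow_le_rpow_of_exponent_le hC₃1 hqinf1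
      exact (ENNReal.rpow_le_rpow_iff hqinf0).1 h1
    set u := v / C₃ with hu
    have hvu : v = C₃ * u := by rw [hu, ENNReal.mul_div_cancel hC₃0 hC₃t]
    have hu1 : u ≤ 1 := by
      rw [hu]; exact ENNReal.div_le_of_le_mul (by rwa [one_mul])
    have huv : u ≤ v := by
      rw [hvu]; exact le_mul_of_one_le_left zero_le hC₃1
    have ham : a ≤ 𝒟.maxFn 1 0 k g x := by
      simpa using CellFiltration.le_maxFn (𝒞 := 𝒟) 1 hl'.1 hl'.2 g x
    calc v ^ q x = C₃ ^ q x * u ^ q x := by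
          rw [hvu, ENNReal.mul_rpow_of_nonneg _ _ (hq0 x).le]
      _ ≤ C₃ ^ Q * (K₂ * u ^ qinf + decay x) := by
          refine mul_le_mul' (ENNReal.rpow_le_rpow_of_exponent_le hC₃1 (hqQ x)) ?_
          exact rpow_le_add_decay hu1 (hq1 x) (by positivity) (hqdiff x)
      _ ≤ C₃ ^ Q * (K₂ * (C₃ * a ^ pinf) + decay x) := by
          gcongr
          exact (ENNReal.rpow_le_rpow huv hqinf0.le).trans hvq
      _ ≤ C₃ ^ Q * (K₂ * C₃ * 𝒟.maxFn 1 0 k g x ^ pinf + decay x) := by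
          rw [← mul_assoc K₂]
          gcongr
  have hdoob := CellFiltration.setLIntegral_maxFn_rpow_le (𝒞 := 𝒟) hg hpinf1 k
    (D := Set.univ) (fun _ _ _ _ => trivial)
  simp only [Measure.restrict_univ] at hdoob
  have hmm : Measurable fun x => 𝒟.maxFn 1 0 k g x ^ pinf :=
    (CellFiltration.measurable_maxFn _ _ _ _).pow_const _
  calc ∫⁻ x, 𝒟.maxFn (fun i => 𝒟.mass i ^ β) 0 k g x ^ q x
      ≤ ∫⁻ x, C₃ ^ Q * (K₂ * C₃ * 𝒟.maxFn 1 0 k g x ^ pinf + decay x) := lintegral_mono hpt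
    _ = C₃ ^ Q * (K₂ * C₃ * (∫⁻ x, 𝒟.maxFn 1 0 k g x ^ pinf) + I) := by
        rw [lintegral_const_mul' _ _ hC₃Q, lintegral_add_right _ measurable_decay,
          lintegral_const_mul _ hmm]
    _ ≤ _ := by
        gcongr
        exact hdoob.trans (mul_le_mul' le_rfl hgp)

/-- The modular estimate for the dyadic fractional maximal function. -/
theorem exists_lintegral_maxFn_rpow_le {n : ℕ} (hn : 0 < n) {p q : Rn n → ℝ}
    {r R Q β : ℝ} (hp : LogHolderExponent p r R) (hβ : 0 ≤ β) (hβR : β < 1 / R)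
    (hqm : Measurable q)
    (hq0 : ∀ x, 0 < q x) (hqQ : ∀ x, q x ≤ Q) (hq : ∀ x, 1 / q x = 1 / p x - β) :
    ∃ C : ℝ≥0∞, C ≠ ⊤ ∧ ∀ (t : Rn n) (δ : ℝ) (hδ : 0 < δ) (k : ℕ) (g : Rn n → ℝ≥0∞),
      Measurable g → ∫⁻ y, g y ^ p y ≤ 1 →
        ∫⁻ x, (dyadicGrid t hδ).maxFn (fun i => (dyadicGrid t hδ).mass i ^ β) 0 k g x ^ q x ≤
          C := by
  obtain ⟨C₁, hC₁t, hC₁⟩ := exists_lintegral_maxFn_rpow_le_of_one_le hn hp hβ hq0 hqQ hq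
  obtain ⟨C₂, hC₂t, hC₂⟩ := exists_lintegral_maxFn_rpow_le_of_le_one hn hp hβ hβR hq0 hqQ hq
  have hQ0 : 0 ≤ Q := (hq0 0).le.trans (hqQ 0)
  have h2Q : (2 : ℝ≥0∞) ^ Q ≠ ⊤ := ENNReal.rpow_ne_top_of_nonneg hQ0 (by simp)
  refine ⟨2 ^ Q * (C₁ + C₂), ENNReal.mul_ne_top h2Q (ENNReal.add_ne_top.2 ⟨hC₁t, hC₂t⟩), ?_⟩
  intro t δ hδ k g hg hint
  set 𝒟 := dyadicGrid t hδ
  set w : ℕ → ℝ≥0∞ := fun i => 𝒟.mass i ^ β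
  set E : Set (Rn n) := {y | 1 < g y} with hE
  have hEm : MeasurableSet E := measurableSet_lt measurable_const hg
  set g₁ := E.indicator g with hg₁
  set g₂ := Eᶜ.indicator g with hg₂
  have hg₁m : Measurable g₁ := hg.indicator hEm
  have hg₂m : Measurable g₂ := hg.indicator hEm.compl
  have hle : ∀ f : Rn n → ℝ≥0∞, (∀ y, f y ≤ g y) → ∫⁻ y, f y ^ p y ≤ 1 := fun f hf =>
    (lintegral_mono fun y => ENNReal.rpow_le_rpow (hf y)
      (by linarith [hp.le y, hp.one_lt])).trans hint
  have h₁ := hC₁ t δ hδ k g₁ hg₁m (fun y => by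
    by_cases hy : y ∈ E
    · right
      rw [hg₁, Set.indicator_of_mem hy]
      exact (show 1 < g y from hy).le
    · left
      rw [hg₁, Set.indicator_of_notMem hy]) (hle _ fun y => Set.indicator_le_self _ _ y)
  have h₂ := hC₂ t δ hδ k g₂ hg₂m (fun y => by
    by_cases hy : y ∈ E
    · rw [hg₂, Set.indicator_of_notMem (by simpa using hy)]
      exact zero_le
    · rw [hg₂, Set.indicator_of_mem (by simpa using hy)]
      exact not_lt.1 hy) (hle _ fun y => Set.indicator_le_self _ _ y)
  have hsum : (fun y => g₁ y + g₂ y) = g := by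
    funext y
    exact congrFun (Set.indicator_self_add_compl E g) y
  have hpt : ∀ x, 𝒟.maxFn w 0 k g x ^ q x ≤
      2 ^ Q * (𝒟.maxFn w 0 k g₁ x ^ q x + 𝒟.maxFn w 0 k g₂ x ^ q x) := by
    intro x
    have h3 : 𝒟.maxFn w 0 k g x ≤ 𝒟.maxFn w 0 k g₁ x + 𝒟.maxFn w 0 k g₂ x := by
      conv_lhs => rw [← hsum]
      exact CellFiltration.maxFn_add_le w 0 k hg₁m x
    set u := 𝒟.maxFn w 0 k g₁ x
    set v := 𝒟.maxFn w 0 k g₂ x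
    have h4 : u + v ≤ 2 * max u v := by
      rw [two_mul]; exact add_le_add (le_max_left _ _) (le_max_right _ _)
    calc 𝒟.maxFn w 0 k g x ^ q x ≤ (2 * max u v) ^ q x :=
          ENNReal.rpow_le_rpow (h3.trans h4) (hq0 x).le
      _ = 2 ^ q x * max u v ^ q x := ENNReal.mul_rpow_of_nonneg _ _ (hq0 x).le
      _ ≤ 2 ^ Q * (u ^ q x + v ^ q x) := by
          refine mul_le_mul' (ENNReal.rpow_le_rpow_of_exponent_le one_le_two (hqQ x)) ?_
          rcases le_total u v with huv | huv
          · rw [max_eq_right huv]; exact le_add_self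
          · rw [max_eq_left huv]; exact le_self_add
  calc ∫⁻ x, 𝒟.maxFn w 0 k g x ^ q x
      ≤ ∫⁻ x, 2 ^ Q * (𝒟.maxFn w 0 k g₁ x ^ q x + 𝒟.maxFn w 0 k g₂ x ^ q x) :=
        lintegral_mono hpt
    _ = 2 ^ Q * ((∫⁻ x, 𝒟.maxFn w 0 k g₁ x ^ q x) + ∫⁻ x, 𝒟.maxFn w 0 k g₂ x ^ q x) := by
        rw [lintegral_const_mul' _ _ h2Q, lintegral_add_left]
        exact (CellFiltration.measurable_maxFn _ _ _ _).pow hqm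
    _ ≤ _ := by gcongr

/-! ### Duality and the vector-valued dyadic inequality -/

theorem lintegral_le_of_le_liminf {X : Type*} [MeasurableSpace X] {μ : Measure X}
    {F : X → ℝ≥0∞} {G : ℕ → X → ℝ≥0∞} {c : ℝ≥0∞} (hG : ∀ m, Measurable (G m))
    (hle : ∀ m, ∫⁻ x, G m x ∂μ ≤ c)
    (h : ∀ x, F x ≤ Filter.liminf (fun m => G m x) Filter.atTop) : ∫⁻ x, F x ∂μ ≤ c :=
  (lintegral_mono h).trans <| (lintegral_liminf_le hG).trans <|
    (Filter.liminf_le_liminf (Filter.Eventually.of_forall hle)).trans (by simp)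

theorem tendsto_div_rpow {u : ℕ → ℝ≥0∞} {v : ℝ≥0∞}
    (h : Filter.Tendsto u Filter.atTop (nhds v)) {c : ℝ≥0∞} (hc : c ≠ 0) (q : ℝ) :
    Filter.Tendsto (fun m => (u m / c) ^ q) Filter.atTop (nhds ((v / c) ^ q)) :=
  (ENNReal.continuous_rpow_const.tendsto _).comp (ENNReal.Tendsto.div_const h (Or.inr hc))

/-- A norm estimate in a variable Lebesgue space by duality, for a function of finite modular. -/
theorem lintegral_div_rpow_le_one_of_forall_lintegral_mul_le {X : Type*} [MeasurableSpace X]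
    {μ : Measure X} {q q' : X → ℝ} {Q : ℝ} (hqm : Measurable q)
    (hq : ∀ x, (q x).HolderConjugate (q' x))
    (hqQ : ∀ x, q x ≤ Q) {U : X → ℝ≥0∞} (hU : Measurable U) {B : ℝ≥0∞} (hB0 : B ≠ 0)
    (hBt : B ≠ ⊤) (hfin : ∫⁻ x, (U x / (2 ^ Q * B)) ^ q x ∂μ ≠ ⊤)
    (hdual : ∀ h : X → ℝ≥0∞, Measurable h → ∫⁻ x, h x ^ q' x ∂μ ≤ 1 → ∫⁻ x, U x * h x ∂μ ≤ B) :
    ∫⁻ x, (U x / (2 ^ Q * B)) ^ q x ∂μ ≤ 1 := by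
  rcases isEmpty_or_nonempty X with hX | ⟨⟨x₀⟩⟩
  · simp [Measure.eq_zero_of_isEmpty μ]
  have hQ0 : 0 ≤ Q := (hq x₀).nonneg.trans (hqQ x₀)
  have hq0 : ∀ x, 0 ≤ q x := fun x => (hq x).nonneg
  have h2t : ∀ k : ℕ, (2 : ℝ≥0∞) ^ k ≠ ⊤ := fun k => ENNReal.pow_ne_top (by simp)
  have h20 : ∀ k : ℕ, (2 : ℝ≥0∞) ^ k ≠ 0 := fun k => pow_ne_zero _ two_ne_zero
  have h2Qt : (2 : ℝ≥0∞) ^ Q ≠ ⊤ := ENNReal.rpow_ne_top_of_nonneg hQ0 (by simp)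
  have h2Q0 : (2 : ℝ≥0∞) ^ Q ≠ 0 := by simp [ENNReal.rpow_eq_zero_iff]
  set C := 2 ^ Q * B with hC
  have hC0 : C ≠ 0 := mul_ne_zero h2Q0 hB0
  have hCt : C ≠ ⊤ := ENNReal.mul_ne_top h2Qt hBt
  set Φ : ℕ → ℝ≥0∞ := fun k => ∫⁻ x, (U x / (C * 2 ^ k)) ^ q x ∂μ with hΦ
  have hsplit : ∀ (k : ℕ) (x : X), U x / (C * 2 ^ k) = U x / C * (2 ^ k)⁻¹ := fun k x => by
    rw [div_eq_mul_inv, ENNReal.mul_inv (Or.inl hC0) (Or.inl hCt), ← mul_assoc,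
      div_eq_mul_inv (U x) C]
  have hΦ0 : Φ 0 = ∫⁻ x, (U x / C) ^ q x ∂μ := by simp [hΦ]
  by_contra hcon
  rw [← hΦ0] at hcon hfin
  have hex : ∃ k, Φ k ≤ 1 := by
    obtain ⟨N, hN⟩ := ENNReal.exists_nat_gt hfin
    refine ⟨N, ?_⟩
    have hN2 : Φ 0 ≤ 2 ^ N := hN.le.trans (by exact_mod_cast Nat.lt_two_pow_self.le)
    calc Φ N ≤ ∫⁻ x, (2 ^ N)⁻¹ * (U x / C) ^ q x ∂μ := by
          refine lintegral_mono fun x => ?_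
          rw [hsplit, ENNReal.mul_rpow_of_nonneg _ _ (hq0 x), mul_comm]
          gcongr
          calc ((2 : ℝ≥0∞) ^ N)⁻¹ ^ q x ≤ ((2 : ℝ≥0∞) ^ N)⁻¹ ^ (1 : ℝ) :=
                ENNReal.rpow_le_rpow_of_exponent_ge
                  (ENNReal.inv_le_one.2 (one_le_pow₀ one_le_two)) (hq x).lt.le
            _ = _ := ENNReal.rpow_one _
      _ = (2 ^ N)⁻¹ * Φ 0 := by
          rw [hΦ0, lintegral_const_mul' _ _ (ENNReal.inv_ne_top.2 (h20 N))]
      _ ≤ (2 ^ N)⁻¹ * 2 ^ N := by gcongr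
      _ = 1 := ENNReal.inv_mul_cancel (h20 N) (h2t N)
  classical
  obtain ⟨k, hk, hmin⟩ : ∃ k, Φ (k + 1) ≤ 1 ∧ ¬ Φ k ≤ 1 := by
    have h1 := Nat.find_spec hex
    have h0 : Nat.find hex ≠ 0 := fun h => hcon (h ▸ h1)
    obtain ⟨k, hk⟩ := Nat.exists_eq_succ_of_ne_zero h0
    refine ⟨k, ?_, Nat.find_min hex (by omega)⟩
    rw [hk] at h1
    exact h1
  set lam := C * 2 ^ (k + 1) with hlam
  have hlam0 : lam ≠ 0 := mul_ne_zero hC0 (h20 _)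
  have hlamt : lam ≠ ⊤ := ENNReal.mul_ne_top hCt (h2t _)
  have hstep : Φ k ≤ 2 ^ Q * Φ (k + 1) := by
    rw [hΦ, ← lintegral_const_mul' _ _ h2Qt]
    refine lintegral_mono fun x => ?_
    have e : U x / (C * 2 ^ k) = 2 * (U x / (C * 2 ^ (k + 1))) := by
      rw [hsplit, hsplit, pow_succ, ENNReal.mul_inv (Or.inl (h20 k)) (Or.inl (h2t k))]
      calc U x / C * (2 ^ k)⁻¹ = (2 * 2⁻¹) * (U x / C * (2 ^ k)⁻¹) := by
            rw [ENNReal.mul_inv_cancel (by simp) (by simp), one_mul]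
        _ = _ := by ring
    simp only [e]
    rw [ENNReal.mul_rpow_of_nonneg _ _ (hq0 x)]
    gcongr
    · exact one_le_two
    · exact hqQ x
  set h : X → ℝ≥0∞ := fun x => (U x / lam) ^ (q x - 1) with hh
  have hhm : Measurable h := (hU.div_const lam).pow (hqm.sub_const 1)
  have hhint : ∫⁻ x, h x ^ q' x ∂μ ≤ 1 := by
    refine le_trans (le_of_eq (lintegral_congr fun x => ?_)) hk
    rw [hh, ← ENNReal.rpow_mul, (hq x).sub_one_mul_conj]
  have hUh : ∫⁻ x, U x * h x ∂μ = lam * Φ (k + 1) := by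
    rw [hΦ, ← lintegral_const_mul' _ _ hlamt]
    refine lintegral_congr fun x => ?_
    have e1 : U x = lam * (U x / lam) := by rw [ENNReal.mul_div_cancel hlam0 hlamt]
    have e2 : (U x / lam) ^ q x = U x / lam * (U x / lam) ^ (q x - 1) := by
      conv_rhs => rw [← ENNReal.rpow_one (U x / lam), ← ENNReal.rpow_mul, one_mul,
        ← ENNReal.rpow_add_of_nonneg _ _ zero_le_one (by linarith [(hq x).lt]), add_sub_cancel]
    simp only [hh, ← hlam]
    rw [e2, ← mul_assoc, ← e1]
  have hB := hdual h hhm hhint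
  rw [hUh] at hB
  have h1 : 1 < 2 ^ Q * Φ (k + 1) := (not_le.1 hmin).trans_le hstep
  have h2 : lam < C := by
    calc lam = lam * 1 := (mul_one _).symm
      _ < lam * (2 ^ Q * Φ (k + 1)) := (ENNReal.mul_lt_mul_iff_right hlam0 hlamt).2 h1
      _ = 2 ^ Q * (lam * Φ (k + 1)) := by ring
      _ ≤ C := by rw [hC]; gcongr
  exact absurd h2 (not_lt.2 (le_mul_of_one_le_right zero_le (one_le_pow₀ one_le_two)))

/-- A norm estimate in a variable Lebesgue space by duality. -/
theorem lintegral_div_rpow_le_one_of_dual {n : ℕ} {q q' : Rn n → ℝ} {Q : ℝ} (hqm : Measurable q)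
    (hq : ∀ x, (q x).HolderConjugate (q' x)) (hqQ : ∀ x, q x ≤ Q) {V : Rn n → ℝ≥0∞}
    (hV : Measurable V) {B : ℝ≥0∞} (hB0 : B ≠ 0) (hBt : B ≠ ⊤)
    (hdual : ∀ h : Rn n → ℝ≥0∞, Measurable h → ∫⁻ x, h x ^ q' x ≤ 1 → ∫⁻ x, V x * h x ≤ B) :
    ∫⁻ x, (V x / (2 ^ Q * B)) ^ q x ≤ 1 := by
  have hQ0 : 0 ≤ Q := (hq 0).nonneg.trans (hqQ 0)
  have h2Q0 : (2 : ℝ≥0∞) ^ Q ≠ 0 := by simp [ENNReal.rpow_eq_zero_iff]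
  have hC0 : 2 ^ Q * B ≠ 0 := mul_ne_zero h2Q0 hB0
  set U : ℕ → Rn n → ℝ≥0∞ := fun m =>
    (Metric.ball (0 : Rn n) m).indicator fun x => min (V x) m with hUdef
  have hUm : ∀ m, Measurable (U m) := fun m =>
    (hV.min measurable_const).indicator measurableSet_ball
  have hUV : ∀ m x, U m x ≤ V x := fun m x =>
    Set.indicator_le' (fun _ _ => min_le_left _ _) (fun _ _ => zero_le) x
  refine lintegral_le_of_le_liminf (G := fun m x => (U m x / (2 ^ Q * B)) ^ q x)
    (fun m => ((hUm m).div_const _).pow hqm) (fun m => ?_) fun x => ?_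
  · refine lintegral_div_rpow_le_one_of_forall_lintegral_mul_le hqm hq hqQ (hUm m) hB0 hBt ?_
      fun h hh hint => (lintegral_mono fun x => mul_le_mul' (hUV m x) le_rfl).trans
        (hdual h hh hint)
    set c : ℝ≥0∞ := m / (2 ^ Q * B) + 1 with hc
    have hct : c ^ Q ≠ ⊤ := ENNReal.rpow_ne_top_of_nonneg hQ0
      (ENNReal.add_ne_top.2 ⟨ENNReal.div_ne_top (by simp) hC0, by simp⟩)
    refine ne_top_of_le_ne_top (b := ∫⁻ x in Metric.ball (0 : Rn n) m, c ^ Q) ?_ ?_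
    · rw [setLIntegral_const]
      exact ENNReal.mul_ne_top hct measure_ball_lt_top.ne
    · rw [← lintegral_indicator measurableSet_ball]
      refine lintegral_mono fun x => ?_
      by_cases hx : x ∈ Metric.ball (0 : Rn n) m
      · simp only [hUdef, Set.indicator_of_mem hx]
        calc (min (V x) m / (2 ^ Q * B)) ^ q x ≤ c ^ q x := by
              refine ENNReal.rpow_le_rpow (le_add_right ?_) (hq x).nonneg
              exact ENNReal.div_le_div_right (min_le_right _ _) _
          _ ≤ c ^ Q := ENNReal.rpow_le_rpow_of_exponent_le le_add_self (hqQ x)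
      · simp only [hUdef, Set.indicator_of_notMem hx, ENNReal.zero_div]
        rw [ENNReal.zero_rpow_of_pos (hq x).pos]
  · have hlim : Filter.Tendsto (fun m => U m x) Filter.atTop (nhds (V x)) := by
      have h1 : Filter.Tendsto (fun m : ℕ => min (V x) (m : ℝ≥0∞)) Filter.atTop
          (nhds (min (V x) ⊤)) :=
        Filter.Tendsto.min tendsto_const_nhds ENNReal.tendsto_nat_nhds_top
      rw [min_eq_left le_top] at h1
      refine h1.congr' ?_
      obtain ⟨N, hN⟩ := exists_nat_gt ‖x‖
      filter_upwards [Filter.eventually_ge_atTop N] with m hm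
      have hx : x ∈ Metric.ball (0 : Rn n) m := by
        rw [mem_ball_zero_iff]
        exact hN.trans_le (by exact_mod_cast hm)
      simp only [hUdef, Set.indicator_of_mem hx]
    exact (tendsto_div_rpow hlim hC0 (q x)).liminf_eq.ge

/-- The conjugate exponent of `q`, where `1 / q = 1 / p - β`, is log-Hölder continuous. -/
theorem LogHolderExponent.conj {n : ℕ} (hn : 0 < n) {p : Rn n → ℝ} {r R β : ℝ}
    (hp : LogHolderExponent p r R) (hβ : 0 ≤ β) (hβR : β < 1 / R) :
    LogHolderExponent (fun x => 1 / (1 + β - 1 / p x)) (1 / (1 + β - 1 / R))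
      (1 / (1 + β - 1 / r)) := by
  have hr1 := hp.one_lt
  have hr0 : 0 < r := by linarith
  have hrR : r ≤ R := (hp.le 0).trans (hp.ge 0)
  have hR0 : 0 < R := hr0.trans_le hrR
  have hinv : 1 / r < 1 := by rw [div_lt_one hr0]; exact hr1
  have hd : 0 < 1 + β - 1 / r := by linarith
  have hmono : ∀ {u v : ℝ}, r ≤ u → u ≤ v → 1 + β - 1 / u ≤ 1 + β - 1 / v := fun hu huv => by
    have := one_div_le_one_div_of_le (hr0.trans_le hu) huv
    linarith
  have hdpos : ∀ {u : ℝ}, r ≤ u → 0 < 1 + β - 1 / u := fun hu => hd.trans_le (hmono le_rfl hu)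
  set L : ℝ := 1 / (1 + β - 1 / r) with hL
  have hL0 : 0 < L := one_div_pos.2 hd
  have hlip : ∀ {u v : ℝ}, r ≤ u → r ≤ v →
      |1 / (1 + β - 1 / u) - 1 / (1 + β - 1 / v)| ≤ L * L * |u - v| := by
    intro u v hu hv
    have hu0 : 0 < u := hr0.trans_le hu
    have hv0 : 0 < v := hr0.trans_le hv
    have hdu := hdpos hu
    have hdv := hdpos hv
    have e : 1 / (1 + β - 1 / u) - 1 / (1 + β - 1 / v) =
        1 / (1 + β - 1 / u) * (1 / (1 + β - 1 / v)) * ((v - u) / (u * v)) := by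
      have e1 : (v - u) / (u * v) = (1 + β - 1 / v) - (1 + β - 1 / u) := by
        field_simp; ring
      rw [e1]
      generalize 1 + β - 1 / u = d₁ at hdu ⊢
      generalize 1 + β - 1 / v = d₂ at hdv ⊢
      field_simp
    rw [e, abs_mul, abs_of_pos (by positivity), abs_div, abs_of_pos (mul_pos hu0 hv0), abs_sub_comm]
    have h1 : |u - v| / (u * v) ≤ |u - v| := div_le_self (abs_nonneg _) (by nlinarith)
    have h2 : 1 / (1 + β - 1 / u) ≤ L := one_div_le_one_div_of_le hd (hmono le_rfl hu)
    have h3 : 1 / (1 + β - 1 / v) ≤ L := one_div_le_one_div_of_le hd (hmono le_rfl hv)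
    gcongr
  refine ⟨?_, fun x => ?_, fun x => ?_, ?_, ?_⟩
  · rw [lt_div_iff₀ (hdpos hrR)]; linarith
  · exact one_div_le_one_div_of_le (hdpos (hp.le x)) (hmono (hp.le x) (hp.ge x))
  · exact one_div_le_one_div_of_le hd (hmono le_rfl (hp.le x))
  · obtain ⟨c, hc, h⟩ := hp.locally
    refine ⟨L * L * c, by positivity, fun x y hxy => ?_⟩
    refine (hlip (hp.le x) (hp.le y)).trans ?_
    rw [mul_div_assoc]
    exact mul_le_mul_of_nonneg_left (h x y hxy) (by positivity)
  · obtain ⟨C, hC, pinf, h⟩ := hp.infty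
    obtain ⟨hrp, _⟩ := logHolderInfty_limit_mem hn hp.le hp.ge h
    refine ⟨L * L * C, by positivity, 1 / (1 + β - 1 / pinf), fun x => ?_⟩
    refine (hlip (hp.le x) hrp).trans ?_
    rw [mul_div_assoc]
    exact mul_le_mul_of_nonneg_left (h x) (by positivity)

/-- The vector-valued inequality for the dyadic fractional maximal function. -/
theorem exists_lintegral_seqNorm_maxFn_le_one {n : ℕ} (hn : 0 < n) {p q : Rn n → ℝ}
    {r R β θ : ℝ} (hp : LogHolderExponent p r R) (hβ : 0 ≤ β) (hβR : β < 1 / R)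
    (hq : ∀ x, 1 / q x = 1 / p x - β) (hθ : 1 < θ) :
    ∃ C : ℝ≥0∞, C ≠ 0 ∧ C ≠ ⊤ ∧ ∀ (t : Rn n) (δ : ℝ) (hδ : 0 < δ) (k : ℕ)
      (f : ℕ → Rn n → ℝ≥0∞), (∀ j, Measurable (f j)) →
      ∫⁻ x, (seqNorm θ fun j => f j x) ^ p x ≤ 1 →
      ∫⁻ x, ((seqNorm θ fun j => (dyadicGrid t hδ).maxFn
        (fun i => (dyadicGrid t hδ).mass i ^ β) 0 k (f j) x) / C) ^ q x ≤ 1 := by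
  have hr1 := hp.one_lt
  have hr0 : 0 < r := by linarith
  have hpm : Measurable p := hp.locally.continuous.measurable
  have hp0 : ∀ x, 0 < p x := fun x => hr0.trans_le (hp.le x)
  have hR0 : 0 < R := (hp0 0).trans_le (hp.ge 0)
  have hinv : ∀ x, 1 / R - β ≤ 1 / p x - β := fun x => by
    have := one_div_le_one_div_of_le (hp0 x) (hp.ge x)
    linarith
  have hβR' : 0 < 1 / R - β := by linarith
  have hqe : ∀ x, q x = 1 / (1 / p x - β) := fun x => by rw [← hq x, one_div_one_div]
  have hq0 : ∀ x, 0 < q x := fun x => by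
    rw [hqe]; exact one_div_pos.2 (hβR'.trans_le (hinv x))
  have hqm : Measurable q := by
    have : q = fun x => 1 / (1 / p x - β) := funext hqe
    rw [this]; fun_prop
  set Q : ℝ := 1 / (1 / R - β)
  have hqQ : ∀ x, q x ≤ Q := fun x => by
    rw [hqe]; exact one_div_le_one_div_of_le hβR' (hinv x)
  set q' : Rn n → ℝ := fun x => 1 / (1 + β - 1 / p x) with hq'
  have hp' := hp.conj hn hβ hβR
  have hconj : ∀ x, (q x).HolderConjugate (q' x) := by
    intro x
    rw [Real.holderConjugate_iff]
    constructor
    · have h1 : 1 / p x < 1 := by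
        rw [div_lt_one (hp0 x)]; exact hr1.trans_le (hp.le x)
      have h2 : 1 / q x < 1 := by rw [hq x]; linarith
      rwa [div_lt_one (hq0 x)] at h2
    · rw [hq']
      simp only [one_div, inv_inv]
      have := hq x
      simp only [one_div] at this
      rw [this]; ring
  obtain ⟨C₁, hC₁t, hC₁⟩ := exists_lintegral_maxFn_rpow_le hn hp hβ hβR hqm hq0 hqQ hq
  obtain ⟨C₂, hC₂t, hC₂⟩ := exists_lintegral_maxFn_rpow_le hn hp' le_rfl
    (one_div_pos.2 ((hconj 0).symm.pos.trans_le (hp'.ge 0))) hp'.locally.continuous.measurable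
    (fun x => (hconj x).symm.pos) hp'.ge (fun x => (sub_zero _).symm)
  have hD1 : (1 : ℝ≥0∞) ≤ 2 ^ n := one_le_pow₀ one_le_two
  have hDt : (2 : ℝ≥0∞) ^ n ≠ ⊤ := ENNReal.pow_ne_top (by simp)
  set A := CellFiltration.vectorWeakConst (2 ^ n) θ with hA
  have hAt : A ≠ ⊤ := CellFiltration.vectorWeakConst_ne_top hDt θ
  have hQ0 : 0 ≤ Q := (hq0 0).le.trans (hqQ 0)
  have h2Q0 : (2 : ℝ≥0∞) ^ Q ≠ 0 := by simp [ENNReal.rpow_eq_zero_iff]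
  set B := 2 * A * (C₁ + C₂) + 1 with hB
  have hB0 : B ≠ 0 := by simp [hB]
  have hBt : B ≠ ⊤ := ENNReal.add_ne_top.2 ⟨ENNReal.mul_ne_top (ENNReal.mul_ne_top (by simp) hAt)
    (ENNReal.add_ne_top.2 ⟨hC₁t, hC₂t⟩), by simp⟩
  refine ⟨2 ^ Q * B, mul_ne_zero h2Q0 hB0,
    ENNReal.mul_ne_top (ENNReal.rpow_ne_top_of_nonneg hQ0 (by simp)) hBt, ?_⟩
  intro t δ hδ k f hf hint
  set 𝒟 := dyadicGrid t hδ
  set w : ℕ → ℝ≥0∞ := fun i => 𝒟.mass i ^ β with hw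
  set g : Rn n → ℝ≥0∞ := fun x => seqNorm θ fun j => f j x with hg
  have hgm : Measurable g := measurable_seqNorm θ hf
  refine lintegral_div_rpow_le_one_of_dual hqm hconj hqQ
    (measurable_seqNorm θ fun j => CellFiltration.measurable_maxFn _ _ _ _) hB0 hBt ?_
  intro h hh hhint
  have h1 := CellFiltration.setLIntegral_seqNorm_maxFn_mul_le (𝒞 := 𝒟) hθ hf hD1 hDt
    (dyadicGrid_mass_succ_le t hδ) (dyadicGrid_mass_rpow_mono t hδ hβ) hh k
    (S := Set.univ) (fun _ _ _ _ => trivial)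
  simp only [Measure.restrict_univ] at h1
  refine h1.trans (le_add_right (mul_le_mul' le_rfl ?_))
  have hw0 : (fun i => 𝒟.mass i ^ (0 : ℝ)) = 1 := by
    funext i; simp
  have h2 := hC₂ t δ hδ k h hh hhint
  change ∫⁻ x, 𝒟.maxFn (fun i => 𝒟.mass i ^ (0 : ℝ)) 0 k h x ^ q' x ≤ C₂ at h2
  rw [hw0] at h2
  calc ∫⁻ x, 𝒟.maxFn w 0 k g x * 𝒟.maxFn 1 0 k h x
      ≤ ∫⁻ x, (𝒟.maxFn w 0 k g x ^ q x + 𝒟.maxFn 1 0 k h x ^ q' x) := by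
        refine lintegral_mono fun x => (ENNReal.young_inequality _ _ (hconj x)).trans ?_
        refine add_le_add ?_ ?_
        · exact ENNReal.div_le_of_le_mul
            (le_mul_of_one_le_right zero_le (ENNReal.one_le_ofReal.2 (hconj x).lt.le))
        · exact ENNReal.div_le_of_le_mul
            (le_mul_of_one_le_right zero_le (ENNReal.one_le_ofReal.2 (hconj x).symm.lt.le))
    _ = (∫⁻ x, 𝒟.maxFn w 0 k g x ^ q x) + ∫⁻ x, 𝒟.maxFn 1 0 k h x ^ q' x := by
        have hm : Measurable (𝒟.maxFn w 0 k g) := CellFiltration.measurable_maxFn _ _ _ _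
        exact lintegral_add_left (hm.pow hqm) _
    _ ≤ C₁ + C₂ := add_le_add (hC₁ t δ hδ k g hgm hint) h2

/-! ### Reduction to dyadic grids -/

theorem floor_eq_or_floor_sub_eq {lo hi : ℝ} (h : hi - lo ≤ 1 / 3) (N : ℕ) :
    (∀ u ∈ Set.Icc lo hi, ∀ v ∈ Set.Icc lo hi, ⌊u⌋ = ⌊v⌋) ∨
      ∀ u ∈ Set.Icc lo hi, ∀ v ∈ Set.Icc lo hi, ⌊u - 2 ^ N / 3⌋ = ⌊v - 2 ^ N / 3⌋ := by
  have key : ∀ τ : ℝ, ⌊lo - τ⌋ = ⌊hi - τ⌋ →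
      ∀ u ∈ Set.Icc lo hi, ∀ v ∈ Set.Icc lo hi, ⌊u - τ⌋ = ⌊v - τ⌋ := by
    intro τ hτ
    have h1 : ∀ u ∈ Set.Icc lo hi, ⌊u - τ⌋ = ⌊lo - τ⌋ := fun u hu =>
      le_antisymm ((Int.floor_le_floor (by linarith [hu.2])).trans hτ.ge)
        (Int.floor_le_floor (by linarith [hu.1]))
    intro u hu v hv
    rw [h1 u hu, h1 v hv]
  by_cases h0 : ⌊lo⌋ = ⌊hi⌋
  · left
    simpa using key 0 (by simpa using h0)
  by_cases h1 : ⌊lo - 2 ^ N / 3⌋ = ⌊hi - 2 ^ N / 3⌋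
  · exact Or.inr (key _ h1)
  right
  intro u hu
  have hlohi : lo ≤ hi := hu.1.trans hu.2
  exfalso
  have hm : ⌊lo⌋ < ⌊hi⌋ := lt_of_le_of_ne (Int.floor_le_floor hlohi) h0
  have hm' : ⌊lo - 2 ^ N / 3⌋ < ⌊hi - 2 ^ N / 3⌋ :=
    lt_of_le_of_ne (Int.floor_le_floor (by linarith)) h1
  set m := ⌊hi⌋
  set m' := ⌊hi - 2 ^ N / 3⌋
  have a1 : lo < m := Int.floor_lt.1 hm
  have a2 : (m : ℝ) ≤ hi := Int.floor_le hi
  have b1 : lo - 2 ^ N / 3 < m' := Int.floor_lt.1 hm'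
  have b2 : (m' : ℝ) ≤ hi - 2 ^ N / 3 := Int.floor_le _
  have c1 : (3 * (m - m') - 2 ^ N : ℝ) < 1 := by linarith
  have c2 : (-1 : ℝ) < 3 * (m - m') - 2 ^ N := by linarith
  have d1 : 3 * (m - m') - 2 ^ N < (1 : ℤ) := by exact_mod_cast c1
  have d2 : (-1 : ℤ) < 3 * (m - m') - 2 ^ N := by exact_mod_cast c2
  have d3 : (3 : ℤ) ∣ 2 ^ N := ⟨m - m', by omega⟩
  have d4 : (3 : ℤ) ∣ 2 := Int.Prime.dvd_pow' (p := 3) Nat.prime_three (by exact_mod_cast d3)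
  omega

/-- The origins of the shifted dyadic grids. -/
def gridShift {n : ℕ} (T : ℝ) (e : Fin n → Bool) : Rn n :=
  WithLp.toLp 2 fun a => if e a then T / 3 else 0

/-- Each cube of side length `r` is contained in a cube of side length at most `6 * r` of one of
the shifted dyadic grids. -/
theorem exists_cube_subset_cell {n : ℕ} (z : Rn n) {r δ : ℝ} (hδ : 0 < δ) {K : ℕ}
    (h1 : δ ≤ 3 * r) (h2 : 3 * r ≤ δ * 2 ^ K) :
    ∃ i ≤ K, δ * 2 ^ i ≤ 6 * r ∧ ∃ e : Fin n → Bool, ∀ x ∈ cube z r,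
      cube z r ⊆ (dyadicGrid (gridShift (δ * 2 ^ K) e) hδ).cell i x := by
  classical
  have hex : ∃ i, 3 * r ≤ δ * 2 ^ i := ⟨K, h2⟩
  set i := Nat.find hex with hi
  have hi1 : 3 * r ≤ δ * 2 ^ i := Nat.find_spec hex
  have hiK : i ≤ K := Nat.find_min' hex h2
  have hi2 : δ * 2 ^ i ≤ 6 * r := by
    rcases Nat.eq_zero_or_pos i with h0 | h0
    · rw [h0, pow_zero, mul_one]; linarith
    · obtain ⟨j, hj⟩ := Nat.exists_eq_succ_of_ne_zero h0.ne'
      have := Nat.find_min hex (m := j) (by omega)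
      rw [hj, pow_succ]
      linarith
  refine ⟨i, hiK, hi2, ?_⟩
  set s := δ * 2 ^ i with hs
  have hs0 : 0 < s := by positivity
  have hT : δ * 2 ^ K / 3 / s = 2 ^ (K - i) / 3 := by
    have : (2 : ℝ) ^ K = 2 ^ (K - i) * 2 ^ i := by rw [← pow_add]; congr 1; omega
    rw [hs, this]; field_simp
  have hcoord : ∀ a : Fin n, ∃ ea : Bool, ∀ x ∈ cube z r, ∀ y ∈ cube z r,
      ⌊(y a - (if ea then δ * 2 ^ K / 3 else 0)) / s⌋ =
        ⌊(x a - (if ea then δ * 2 ^ K / 3 else 0)) / s⌋ := by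
    intro a
    have hlen : (z a + r / 2) / s - (z a - r / 2) / s ≤ 1 / 3 := by
      rw [← sub_div, div_le_div_iff₀ hs0 (by norm_num)]; linarith
    have hmem : ∀ x ∈ cube z r, x a / s ∈ Set.Icc ((z a - r / 2) / s) ((z a + r / 2) / s) := by
      intro x hx
      have hxa : |x a - z a| ≤ r / 2 := hx a
      have := abs_le.1 hxa
      constructor
      · gcongr; linarith
      · gcongr; linarith
    rcases floor_eq_or_floor_sub_eq hlen (K - i) with h | h
    · refine ⟨false, fun x hx y hy => ?_⟩
      simpa using h _ (hmem y hy) _ (hmem x hx)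
    · refine ⟨true, fun x hx y hy => ?_⟩
      simpa [sub_div, hT] using h _ (hmem y hy) _ (hmem x hx)
  choose e he using hcoord
  refine ⟨e, fun x hx y hy => ?_⟩
  change gridIdx _ _ y = gridIdx _ _ x
  funext a
  exact he a x hx y hy

theorem volume_cube {n : ℕ} (z : Rn n) (r : ℝ) :
    volume (cube z r) = ENNReal.ofReal r ^ n := by
  have e : cube z r = WithLp.ofLp ⁻¹'
      (Set.univ.pi fun a => Set.Icc (z a - r / 2) (z a + r / 2)) := by
    ext x
    simp only [Set.mem_preimage, Set.mem_univ_pi, Set.mem_Icc]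
    change (∀ i, |x i - z i| ≤ r / 2) ↔ _
    refine forall_congr' fun a => ?_
    rw [abs_le]
    constructor
    · rintro ⟨h1, h2⟩; constructor <;> linarith
    · rintro ⟨h1, h2⟩; constructor <;> linarith
  rw [e, (PiLp.volume_preserving_ofLp (Fin n)).measure_preimage
    (MeasurableSet.univ_pi fun _ => measurableSet_Icc).nullMeasurableSet, volume_pi_pi]
  have : ∀ a, z a + r / 2 - (z a - r / 2) = r := fun a => by ring
  simp [this]

/-- The fractional average of `F` over the cube `Q(z, r)`. -/
def fracAvg {n : ℕ} (α : ℝ) (F : Rn n → ℝ≥0∞) (z : Rn n) (r : ℝ) : ℝ≥0∞ :=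
  volume (cube z r) ^ (α / (n : ℝ) - 1) * ∫⁻ y in cube z r, F y

/-- The fractional maximal function over cubes of side length between `(1/2)^L / 3` and
`2^L / 3`. -/
def truncMax {n : ℕ} (α : ℝ) (L : ℕ) (F : Rn n → ℝ≥0∞) (x : Rn n) : ℝ≥0∞ :=
  ⨆ (z : Rn n) (r : ℝ) (_ : (1 / 2) ^ L ≤ 3 * r) (_ : 3 * r ≤ 2 ^ L) (_ : x ∈ cube z r),
    fracAvg α F z r

theorem half_pow_pos (L : ℕ) : (0 : ℝ) < (1 / 2) ^ L := by positivity

theorem half_pow_mul (L : ℕ) : ((1 : ℝ) / 2) ^ L * 2 ^ (2 * L) = 2 ^ L := by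
  rw [two_mul, pow_add, ← mul_assoc, ← mul_pow]; norm_num

/-- The dyadic fractional maximal function in the shifted grid number `e` at scale `L`. -/
def gridMax {n : ℕ} (α : ℝ) (L : ℕ) (e : Fin n → Bool) (F : Rn n → ℝ≥0∞) : Rn n → ℝ≥0∞ :=
  (dyadicGrid (gridShift (2 ^ L) e) (half_pow_pos L)).maxFn
    (fun i => (dyadicGrid (gridShift (2 ^ L) e) (half_pow_pos L)).mass i ^ (α / (n : ℝ)))
    0 (2 * L) F

theorem truncMax_le {n : ℕ} (hn : 0 < n) {α : ℝ} (hα0 : 0 ≤ α) (hαn : α < n) (L : ℕ)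
    (F : Rn n → ℝ≥0∞) (x : Rn n) :
    truncMax α L F x ≤ 6 ^ n * ∑ e : Fin n → Bool, gridMax α L e F x := by
  have hn' : (0 : ℝ) < n := by exact_mod_cast hn
  refine iSup_le fun z => iSup_le fun r => iSup_le fun h1 => iSup_le fun h2 => iSup_le fun hx => ?_
  have hr : 0 < r := by linarith [half_pow_pos L]
  obtain ⟨i, hiK, hi6, e, he⟩ := exists_cube_subset_cell z (half_pow_pos L) (K := 2 * L) h1
    (by rwa [half_pow_mul])
  rw [half_pow_mul] at he
  set 𝒟 := dyadicGrid (gridShift (2 ^ L) e) (half_pow_pos L) with h𝒟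
  have hge : 𝒟.mass i ^ (α / (n : ℝ)) * 𝒟.avg i F x ≤ gridMax α L e F x :=
    CellFiltration.le_maxFn _ (Nat.zero_le i) hiK F x
  have hm0 := 𝒟.mass_ne_zero i
  have hmt := 𝒟.mass_ne_top i
  have hmass : 𝒟.mass i ≤ 6 ^ n * volume (cube z r) := by
    rw [volume_cube z r, ← mul_pow]
    change ENNReal.ofReal _ ^ n ≤ _
    refine pow_le_pow_left' ?_ n
    rw [show (6 : ℝ≥0∞) = ENNReal.ofReal 6 by simp, ← ENNReal.ofReal_mul (by norm_num)]
    exact ENNReal.ofReal_le_ofReal hi6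
  set γ : ℝ := 1 - α / n with hγ
  have hγ0 : 0 ≤ γ := by
    rw [hγ, sub_nonneg, div_le_one hn']; exact hαn.le
  have hγ1 : γ ≤ 1 := by
    rw [hγ]; linarith [div_nonneg hα0 hn'.le]
  have hv : volume (cube z r) ^ (α / (n : ℝ) - 1) ≤
      6 ^ n * 𝒟.mass i ^ (α / (n : ℝ) - 1) := by
    have e1 : α / (n : ℝ) - 1 = -γ := by rw [hγ]; ring
    rw [e1, ENNReal.rpow_neg, ENNReal.rpow_neg, ← div_eq_mul_inv,
      ENNReal.le_div_iff_mul_le (Or.inl (by simp [ENNReal.rpow_eq_zero_iff, hm0, hmt]))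
        (Or.inl (ENNReal.rpow_ne_top_of_nonneg hγ0 hmt)), mul_comm, ← div_eq_mul_inv]
    refine ENNReal.div_le_of_le_mul ?_
    calc 𝒟.mass i ^ γ ≤ (6 ^ n * volume (cube z r)) ^ γ := ENNReal.rpow_le_rpow hmass hγ0
      _ = (6 ^ n) ^ γ * volume (cube z r) ^ γ := ENNReal.mul_rpow_of_nonneg _ _ hγ0
      _ ≤ 6 ^ n * volume (cube z r) ^ γ := by
        gcongr
        have h6 : (1 : ℝ≥0∞) ≤ 6 ^ n := one_le_pow₀ (by norm_num)
        calc ((6 : ℝ≥0∞) ^ n) ^ γ ≤ (6 ^ n) ^ (1 : ℝ) :=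
              ENNReal.rpow_le_rpow_of_exponent_le h6 hγ1
          _ = 6 ^ n := ENNReal.rpow_one _
  calc fracAvg α F z r ≤ 6 ^ n * 𝒟.mass i ^ (α / (n : ℝ) - 1) * ∫⁻ y in 𝒟.cell i x, F y :=
        mul_le_mul' hv (lintegral_mono_set (he x hx))
    _ = 6 ^ n * (𝒟.mass i ^ (α / (n : ℝ)) * 𝒟.avg i F x) := by
        rw [ENNReal.rpow_sub _ _ hm0 hmt, ENNReal.rpow_one, CellFiltration.avg]
        simp only [div_eq_mul_inv]
        ring
    _ ≤ 6 ^ n * ∑ e : Fin n → Bool, gridMax α L e F x := by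
        gcongr
        exact hge.trans (Finset.single_le_sum (f := fun e => gridMax α L e F x)
          (fun _ _ => zero_le) (Finset.mem_univ e))

theorem truncMax_mono {n : ℕ} (α : ℝ) (F : Rn n → ℝ≥0∞) (x : Rn n) :
    Monotone fun L => truncMax α L F x := by
  intro L L' hL
  refine iSup_mono fun z => iSup_mono fun r => ?_
  refine iSup_mono' fun h1 => ⟨le_trans ?_ h1, iSup_mono' fun h2 => ⟨h2.trans ?_, le_rfl⟩⟩
  · exact pow_le_pow_of_le_one (by norm_num) (by norm_num) hL
  · exact pow_le_pow_right₀ one_le_two hL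

theorem fracAvg_le_iSup_truncMax {n : ℕ} (α : ℝ) (F : Rn n → ℝ≥0∞) {x z : Rn n} {r : ℝ}
    (hr : 0 < r) (hx : x ∈ cube z r) : fracAvg α F z r ≤ ⨆ L, truncMax α L F x := by
  obtain ⟨L₁, hL₁⟩ := exists_pow_lt_of_lt_one (show (0 : ℝ) < 3 * r by positivity)
    (show (1 : ℝ) / 2 < 1 by norm_num)
  obtain ⟨L₂, hL₂⟩ := pow_unbounded_of_one_lt (3 * r) (show (1 : ℝ) < 2 by norm_num)
  have h1 : ((1 : ℝ) / 2) ^ (max L₁ L₂) ≤ 3 * r :=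
    (pow_le_pow_of_le_one (by norm_num) (by norm_num) (le_max_left _ _)).trans hL₁.le
  have h2 : 3 * r ≤ 2 ^ (max L₁ L₂) :=
    hL₂.le.trans (pow_le_pow_right₀ one_le_two (le_max_right _ _))
  refine le_trans ?_ (le_iSup _ (max L₁ L₂))
  exact le_iSup_of_le z (le_iSup_of_le r (le_iSup_of_le h1 (le_iSup_of_le h2
    (le_iSup_of_le hx le_rfl))))

theorem seqNorm_sum_le {κ : Type*} {θ : ℝ} (hθ : 1 ≤ θ) (s : Finset κ) (a : κ → ℕ → ℝ≥0∞) :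
    seqNorm θ (fun j => ∑ e ∈ s, a e j) ≤ ∑ e ∈ s, seqNorm θ (a e) := by
  classical
  induction s using Finset.induction_on with
  | empty => simp [seqNorm, show 0 < θ by linarith]
  | insert e s he ih =>
    simp only [Finset.sum_insert he]
    exact (seqNorm_add_le hθ _ _).trans (add_le_add le_rfl ih)

theorem seqNorm_iSup {θ : ℝ} (hθ : 0 < θ) {a : ℕ → ℕ → ℝ≥0∞} (ha : ∀ j, Monotone fun L => a L j) :
    seqNorm θ (fun j => ⨆ L, a L j) = ⨆ L, seqNorm θ (a L) := by
  have hpow : ∀ {s : ℝ} (_ : 0 < s) (b : ℕ → ℝ≥0∞), (⨆ L, b L) ^ s = ⨆ L, b L ^ s :=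
    fun hs b => (ENNReal.orderIsoRpow _ hs).map_iSup b
  unfold seqNorm
  rw [← hpow (one_div_pos.2 hθ)]
  congr 1
  simp_rw [hpow hθ]
  simp_rw [← lintegral_count]
  exact lintegral_iSup (fun _ => Measurable.of_discrete) fun L L' hL j =>
    ENNReal.rpow_le_rpow (ha j hL) hθ.le

/-- The norm of a finite sum in a variable Lebesgue space. -/
theorem lintegral_sum_div_rpow_le_one {X κ : Type*} [MeasurableSpace X] {μ : Measure X}
    [Fintype κ] [Nonempty κ] {q : X → ℝ} (hq : ∀ x, 1 ≤ q x) (hqm : Measurable q)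
    {V : κ → X → ℝ≥0∞} (hV : ∀ e, Measurable (V e)) {C : ℝ≥0∞}
    (h : ∀ e, ∫⁻ x, (V e x / C) ^ q x ∂μ ≤ 1) :
    ∫⁻ x, ((∑ e, V e x) / (Fintype.card κ * (Fintype.card κ * C))) ^ q x ∂μ ≤ 1 := by
  set T : ℝ≥0∞ := ((Fintype.card κ : ℕ) : ℝ≥0∞) with hT
  have hT0 : T ≠ 0 := by simp [hT]
  have hTt : T ≠ ⊤ := by simp [hT]
  have hT1 : 1 ≤ T := by
    rw [hT]; exact_mod_cast Fintype.card_pos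
  have hpt : ∀ x, ((∑ e, V e x) / (T * (T * C))) ^ q x ≤ T⁻¹ * ∑ e, (V e x / C) ^ q x := by
    intro x
    obtain ⟨e₀, _, he₀⟩ := Finset.exists_max_image Finset.univ (fun e => V e x)
      Finset.univ_nonempty
    have h1 : (∑ e, V e x) / (T * (T * C)) ≤ T⁻¹ * (V e₀ x / C) := by
      have h2 : ∑ e, V e x ≤ T * V e₀ x := by
        refine (Finset.sum_le_card_nsmul _ _ _ fun e he => he₀ e he).trans (le_of_eq ?_)
        rw [nsmul_eq_mul, Finset.card_univ]
      calc (∑ e, V e x) / (T * (T * C)) ≤ T * V e₀ x / (T * (T * C)) :=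
            ENNReal.div_le_div_right h2 _
        _ = V e₀ x / (T * C) := ENNReal.mul_div_mul_left _ _ hT0 hTt
        _ = T⁻¹ * (V e₀ x / C) := by
            rw [div_eq_mul_inv, ENNReal.mul_inv (Or.inl hT0) (Or.inl hTt), div_eq_mul_inv]
            ring
    have hq0 : 0 ≤ q x := by linarith [hq x]
    refine (ENNReal.rpow_le_rpow h1 hq0).trans ?_
    rw [ENNReal.mul_rpow_of_nonneg _ _ hq0]
    refine mul_le_mul' ?_ (Finset.single_le_sum (f := fun e => (V e x / C) ^ q x)
      (fun _ _ => zero_le) (Finset.mem_univ e₀))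
    calc T⁻¹ ^ q x ≤ T⁻¹ ^ (1 : ℝ) :=
          ENNReal.rpow_le_rpow_of_exponent_ge (ENNReal.inv_le_one.2 hT1) (hq x)
      _ = T⁻¹ := ENNReal.rpow_one _
  refine (lintegral_mono hpt).trans ?_
  rw [lintegral_const_mul' _ _ (ENNReal.inv_ne_top.2 hT0),
    lintegral_finsetSum _ fun e _ => ((hV e).div_const C).pow hqm]
  calc T⁻¹ * ∑ e, ∫⁻ x, (V e x / C) ^ q x ∂μ ≤ T⁻¹ * ∑ _e : κ, 1 := by
        gcongr with e
        exact h e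
    _ = 1 := by
        rw [Finset.sum_const, nsmul_one, Finset.card_univ, ENNReal.inv_mul_cancel hT0 hTt]

/-- The modular form of the vector-valued inequality for the fractional maximal operator. -/
theorem exists_lintegral_seqNorm_iSup_truncMax_le_one {n : ℕ} (hn : 0 < n) {p q : Rn n → ℝ}
    {r R α θ : ℝ} (hp : LogHolderExponent p r R) (hα0 : 0 ≤ α) (hαn : α < n)
    (hαR : α / n < 1 / R) (hq : ∀ x, 1 / q x = 1 / p x - α / n) (hθ : 1 < θ) :
    ∃ C : ℝ≥0∞, C ≠ 0 ∧ C ≠ ⊤ ∧ ∀ f : ℕ → Rn n → ℝ≥0∞, (∀ j, Measurable (f j)) →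
      ∫⁻ x, (seqNorm θ fun j => f j x) ^ p x ≤ 1 →
      ∫⁻ x, ((seqNorm θ fun j => ⨆ L, truncMax α L (f j) x) / C) ^ q x ≤ 1 := by
  have hθ0 : 0 < θ := by linarith
  have hn' : (0 : ℝ) < n := by exact_mod_cast hn
  have hβ : 0 ≤ α / n := div_nonneg hα0 hn'.le
  have hpm : Measurable p := hp.locally.continuous.measurable
  have hqe : ∀ x, q x = 1 / (1 / p x - α / n) := fun x => by rw [← hq x, one_div_one_div]
  have hqm : Measurable q := by
    have : q = fun x => 1 / (1 / p x - α / n) := funext hqe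
    rw [this]; fun_prop
  have hp1 : ∀ x, 1 < p x := fun x => hp.one_lt.trans_le (hp.le x)
  have hq1 : ∀ x, 1 ≤ q x := by
    intro x
    have hpx : 0 < p x := by linarith [hp1 x]
    have h1 : 1 / p x ≤ 1 := by
      rw [div_le_one hpx]; exact (hp1 x).le
    have h2 : 1 / R ≤ 1 / p x := one_div_le_one_div_of_le hpx (hp.ge x)
    rw [hqe, le_div_iff₀ (by linarith)]
    linarith
  obtain ⟨C₁, hC₁0, hC₁t, hC₁⟩ :=
    exists_lintegral_seqNorm_maxFn_le_one hn hp hβ hαR hq hθ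
  set T : ℝ≥0∞ := ((Fintype.card (Fin n → Bool) : ℕ) : ℝ≥0∞) with hT
  have hT0 : T ≠ 0 := by rw [hT]; exact_mod_cast Fintype.card_ne_zero
  have hTt : T ≠ ⊤ := by simp [hT]
  have h60 : (6 : ℝ≥0∞) ^ n ≠ 0 := pow_ne_zero _ (by simp)
  have h6t : (6 : ℝ≥0∞) ^ n ≠ ⊤ := ENNReal.pow_ne_top (by simp)
  have hTC0 : T * (T * C₁) ≠ 0 := mul_ne_zero hT0 (mul_ne_zero hT0 hC₁0)
  have hTCt : T * (T * C₁) ≠ ⊤ := ENNReal.mul_ne_top hTt (ENNReal.mul_ne_top hTt hC₁t)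
  have hC0 : 6 ^ n * (T * (T * C₁)) ≠ 0 := mul_ne_zero h60 hTC0
  refine ⟨6 ^ n * (T * (T * C₁)), hC0, ENNReal.mul_ne_top h6t hTCt, ?_⟩
  intro f hf hint
  set V : ℕ → (Fin n → Bool) → Rn n → ℝ≥0∞ := fun L e x =>
    seqNorm θ fun j => gridMax α L e (f j) x with hV
  have hVm : ∀ L e, Measurable (V L e) := fun L e =>
    measurable_seqNorm θ fun j => CellFiltration.measurable_maxFn _ _ _ _
  refine lintegral_le_of_le_liminf
    (G := fun L x => ((∑ e, V L e x) / (T * (T * C₁))) ^ q x)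
    (fun L => ((Finset.measurable_sum _ fun e _ => hVm L e).div_const _).pow hqm)
    (fun L => lintegral_sum_div_rpow_le_one hq1 hqm (hVm L) fun e =>
      hC₁ _ _ (half_pow_pos L) (2 * L) f hf hint) fun x => ?_
  have hmono : ∀ j, Monotone fun L => truncMax α L (f j) x := fun j => truncMax_mono α (f j) x
  rw [seqNorm_iSup hθ0 hmono]
  have hlim : Filter.Tendsto (fun L => seqNorm θ fun j => truncMax α L (f j) x) Filter.atTop
      (nhds (⨆ L, seqNorm θ fun j => truncMax α L (f j) x)) :=
    tendsto_atTop_iSup fun L L' hL => seqNorm_mono hθ0 fun j => hmono j hL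
  rw [← (tendsto_div_rpow hlim hC0 (q x)).liminf_eq]
  refine Filter.liminf_le_liminf (Filter.Eventually.of_forall fun L => ?_)
  refine ENNReal.rpow_le_rpow ?_ (by linarith [hq1 x])
  have h1 : (seqNorm θ fun j => truncMax α L (f j) x) ≤ 6 ^ n * ∑ e, V L e x := by
    calc (seqNorm θ fun j => truncMax α L (f j) x)
        ≤ seqNorm θ fun j => 6 ^ n * ∑ e, gridMax α L e (f j) x :=
          seqNorm_mono hθ0 fun j => truncMax_le hn hα0 hαn L (f j) x
      _ = 6 ^ n * seqNorm θ fun j => ∑ e, gridMax α L e (f j) x := seqNorm_const_mul hθ0 _ _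
      _ ≤ _ := by
          gcongr
          exact seqNorm_sum_le hθ.le Finset.univ fun e j => gridMax α L e (f j) x
  calc _ ≤ 6 ^ n * (∑ e, V L e x) / (6 ^ n * (T * (T * C₁))) := ENNReal.div_le_div_right h1 _
    _ = _ := ENNReal.mul_div_mul_left _ _ h60 h6t

end

theorem vector_valued_fractional_maximal
    {n : ℕ} (α : ℝ) (hα0 : 0 ≤ α) (hαn : α < n)
    (p : Rn n → ℝ)
    (hploc : LogHolderLocal p) (hpinf : LogHolderInfty p)
    (hpm : 1 < (⨅ x, p x))
    (hpbdd : BddAbove (Set.range p))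
    (hpp : 0 < α → (⨆ x, p x) < n / α)
    (q : Rn n → ℝ) (hq : ∀ x, 1 / q x = 1 / p x - α / n)
    (θ : ℝ) (hθ : 1 < θ)
    {𝕜 : Type*} [RCLike 𝕜] :
    ∃ C : ℝ, 0 < C ∧ ∀ f : ℕ → Rn n → 𝕜,
      (∀ j, AEMeasurable (f j) volume) → (∀ j, ∃ M : ℝ, ∀ x, ‖f j x‖ ≤ M) →
      (∀ j, HasCompactSupport (f j)) →
      varLpNorm q (fun x => (∑' j, fracMax α (f j) x ^ θ) ^ (1 / θ)) ≤
        ENNReal.ofReal C * varLpNorm p (fun x => (∑' j, ‖f j x‖ₑ ^ θ) ^ (1 / θ)) := by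
  have hθ0 : 0 < θ := by linarith
  have hn' : (0 : ℝ) < n := hα0.trans_lt hαn
  have hn : 0 < n := by exact_mod_cast hn'
  have hbelow : BddBelow (Set.range p) := by
    by_contra h
    rw [Real.iInf_of_not_bddBelow h] at hpm
    linarith
  have hp : LogHolderExponent p (⨅ x, p x) (⨆ x, p x) :=
    ⟨hpm, ciInf_le hbelow, le_ciSup hpbdd, hploc, hpinf⟩
  have hR0 : 0 < ⨆ x, p x := by
    have h1 := (ciInf_le hbelow (0 : Rn n)).trans (le_ciSup hpbdd 0)
    linarith
  have hαR : α / n < 1 / ⨆ x, p x := by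
    rcases hα0.eq_or_lt with h | h
    · rw [← h, zero_div]; exact one_div_pos.2 hR0
    · have h1 := hpp h
      rw [lt_div_iff₀ h] at h1
      rw [div_lt_div_iff₀ hn' hR0]
      linarith
  obtain ⟨C, hC0, hCt, hC⟩ := exists_lintegral_seqNorm_iSup_truncMax_le_one hn hp hα0 hαn hαR hq hθ
  refine ⟨C.toReal, ENNReal.toReal_pos hC0 hCt, fun f hf _ _ => ?_⟩
  rw [ENNReal.ofReal_toReal hCt]
  have hmain : ∀ lam : ℝ, 0 < lam →
      ∫⁻ x, ((∑' j, ‖f j x‖ₑ ^ θ) ^ (1 / θ) / ENNReal.ofReal lam) ^ p x ≤ 1 →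
      varLpNorm q (fun x => (∑' j, fracMax α (f j) x ^ θ) ^ (1 / θ)) ≤
        C * ENNReal.ofReal lam := by
    intro lam hlam hint
    set ℓ := ENNReal.ofReal lam with hℓ
    have hℓ0 : ℓ ≠ 0 := by simpa [hℓ] using hlam
    have hℓt : ℓ ≠ ⊤ := ENNReal.ofReal_ne_top
    set G : ℕ → Rn n → ℝ≥0∞ := fun j => (hf j).enorm.mk _ with hG
    have hGm : ∀ j, Measurable (G j) := fun j => (hf j).enorm.measurable_mk
    have hGe : ∀ j, (fun x => ‖f j x‖ₑ) =ᵐ[volume] G j := fun j => (hf j).enorm.ae_eq_mk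
    set F : ℕ → Rn n → ℝ≥0∞ := fun j x => ℓ⁻¹ * G j x with hF
    have hFm : ∀ j, Measurable (F j) := fun j => (hGm j).const_mul _
    have hFint : ∫⁻ x, (seqNorm θ fun j => F j x) ^ p x ≤ 1 := by
      refine le_trans (le_of_eq (lintegral_congr_ae ?_)) hint
      filter_upwards [ae_all_iff.2 hGe] with x hx
      have e1 : (seqNorm θ fun j => F j x) = (∑' j, ‖f j x‖ₑ ^ θ) ^ (1 / θ) / ℓ := by
        rw [hF, seqNorm_const_mul hθ0, mul_comm, ← div_eq_mul_inv, seqNorm]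
        simp only [hx]
      rw [e1]
    have hfm : ∀ j x, fracMax α (f j) x ≤ ℓ * ⨆ L, truncMax α L (F j) x := by
      intro j x
      refine iSup_le fun z => iSup_le fun r => iSup_le fun hr => iSup_le fun hx => ?_
      have e2 : ∫⁻ y in cube z r, ‖f j y‖ₑ = ℓ * ∫⁻ y in cube z r, F j y := by
        rw [hF, lintegral_const_mul _ (hGm j), ← mul_assoc, ENNReal.mul_inv_cancel hℓ0 hℓt, one_mul]
        exact lintegral_congr_ae (ae_restrict_of_ae (hGe j))
      rw [e2, mul_left_comm]
      exact mul_le_mul' le_rfl (fracAvg_le_iSup_truncMax α (F j) hr hx)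
    have hres := hC F hFm hFint
    have hCl0 : C * ℓ ≠ 0 := mul_ne_zero hC0 hℓ0
    have hClt : C * ℓ ≠ ⊤ := ENNReal.mul_ne_top hCt hℓt
    refine sInf_le ⟨(C * ℓ).toReal, ⟨ENNReal.toReal_pos hCl0 hClt, ?_⟩, ENNReal.ofReal_toReal hClt⟩
    rw [ENNReal.ofReal_toReal hClt]
    refine le_trans (lintegral_mono fun x => ?_) hres
    refine ENNReal.rpow_le_rpow ?_ ?_
    · have h1 : (∑' j, fracMax α (f j) x ^ θ) ^ (1 / θ) ≤
          ℓ * seqNorm θ fun j => ⨆ L, truncMax α L (F j) x := by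
        rw [← seqNorm_const_mul hθ0]
        exact seqNorm_mono hθ0 fun j => hfm j x
      refine (ENNReal.div_le_div_right h1 _).trans (le_of_eq ?_)
      rw [mul_comm C, ENNReal.mul_div_mul_left _ _ hℓ0 hℓt]
    · have hpx : 0 < p x := by linarith [ciInf_le hbelow x]
      have h2 : 1 / (⨆ x, p x) ≤ 1 / p x := one_div_le_one_div_of_le hpx (le_ciSup hpbdd x)
      have h3 : 0 < 1 / q x := by rw [hq]; linarith
      exact (one_div_pos.1 h3).le
  rw [mul_comm, ← ENNReal.div_le_iff_le_mul (Or.inl hC0) (Or.inl hCt)]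
  refine le_sInf ?_
  rintro _ ⟨lam, ⟨hlam, hint⟩, rfl⟩
  rw [ENNReal.div_le_iff_le_mul (Or.inl hC0) (Or.inl hCt), mul_comm]
  exact hmain lam hlam hint
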